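/- arXiv:2402.07843 — 10 statements merged into one kernel-verified Lean document; each statement's English description precedes it below -/
import Mathlib

section
/- The 2-stabilizer Rényi entropy (with respect to the 4-qubit Pauli basis) of the logical intertwiner basis state |0_s⟩ vanishes: M₂(|0_s⟩) = 0. -/
open Matrix BigOperators

noncomputable section

/-- The four 2×2 Pauli matrices: σ₀ = I, σ₁ = X, σ₂ = Y, σ₃ = Z. -/
def pauli : Fin 4 → Matrix (Fin 2) (Fin 2) ℂ
  | 0 => 1
  | 1 => !![0, 1; 1, 0]
  | 2 => !![0, -Complex.I; Complex.I, 0]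
  | 3 => !![1, 0; 0, -1]

/-- Pauli string `σ_{f(1)} ⊗ ⋯ ⊗ σ_{f(n)}` on `n` qubits, as a matrix on
`(ℂ²)^⊗n`, realized as functions `(Fin n → Fin 2) → ℂ`. -/
def pauliString {n : ℕ} (f : Fin n → Fin 4) :
    Matrix (Fin n → Fin 2) (Fin n → Fin 2) ℂ :=
  Matrix.of fun r c => ∏ k, pauli (f k) (r k) (c k)

/-- Computational basis vector `|b₁…b_n⟩`. -/
def ket {n : ℕ} (b : Fin n → Fin 2) : (Fin n → Fin 2) → ℂ :=
  fun i => if i = b then 1 else 0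

/-- Logical intertwiner basis vector
`|0_s⟩ = ½(|0101⟩+|1010⟩−|0110⟩−|1001⟩)`. -/
def zeroS : (Fin 4 → Fin 2) → ℂ :=
  (2 : ℂ)⁻¹ • (ket ![0,1,0,1] + ket ![1,0,1,0] - ket ![0,1,1,0] - ket ![1,0,0,1])

/-- Logical intertwiner basis vector
`|1_s⟩ = (1/√3)[|0011⟩+|1100⟩ − ½(|0101⟩+|1010⟩+|0110⟩+|1001⟩)]`. -/
def oneS : (Fin 4 → Fin 2) → ℂ :=
  ((Real.sqrt 3 : ℂ))⁻¹ • (ket ![0,0,1,1] + ket ![1,1,0,0]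
    - (2 : ℂ)⁻¹ • (ket ![0,1,0,1] + ket ![1,0,1,0] + ket ![0,1,1,0] + ket ![1,0,0,1]))

/-- The 2-stabilizer Rényi entropy of a state of `(ℂ²)^⊗n` with respect to the `n`-qubit
Pauli basis: `M₂(ψ) = −log₂( d⁻¹ Σ_{P∈𝒫ₙ} ⟨ψ|P|ψ⟩⁴ )` with `d = 2ⁿ`.
Since `⟨ψ|P|ψ⟩` is real for each (Hermitian) Pauli string `P`, we take its real part. -/
def M2 {n : ℕ} (ψ : (Fin n → Fin 2) → ℂ) : ℝ :=
  - Real.logb 2 (((2 : ℝ) ^ n)⁻¹ *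
      ∑ f : Fin n → Fin 4, ((star ψ ⬝ᵥ (pauliString f).mulVec ψ).re) ^ 4)

lemma star_ket {n : ℕ} (b : Fin n → Fin 2) : star (ket b) = ket b := by
  ext i
  by_cases h : i = b <;> simp [ket, h]

lemma ket_eq_single {n : ℕ} (b : Fin n → Fin 2) : ket b = Pi.single b 1 := by
  ext i
  simp [ket, Pi.single_apply]

/-- Matrix elements in the computational basis. -/
lemma ket_dotProduct_mulVec_ket {n : ℕ} (A : Matrix (Fin n → Fin 2) (Fin n → Fin 2) ℂ)
    (b c : Fin n → Fin 2) : ket b ⬝ᵥ A.mulVec (ket c) = A b c := by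
  simp [ket_eq_single]

/-- The expectation value of `σ_a ⊗ σ_b` in the two-qubit singlet `(|01⟩ − |10⟩)/√2`. -/
def singletExpectation (a b : Fin 4) : ℂ :=
  2⁻¹ * (pauli a 0 0 * pauli b 1 1 - pauli a 0 1 * pauli b 1 0
    - pauli a 1 0 * pauli b 0 1 + pauli a 1 1 * pauli b 0 0)

lemma singletExpectation_eq (a b : Fin 4) :
    singletExpectation a b = ((if a = b then if a = 0 then 1 else -1 else 0 : ℝ) : ℂ) := by
  fin_cases a <;> fin_cases b <;> norm_num [singletExpectation, pauli]

/-- `|0_s⟩` is a product of two singlets, so its Pauli expectation values factorize. -/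
lemma zeroS_expectation (f : Fin 4 → Fin 4) :
    star zeroS ⬝ᵥ (pauliString f).mulVec zeroS =
      singletExpectation (f 0) (f 1) * singletExpectation (f 2) (f 3) := by
  simp only [zeroS, star_smul, star_sub, star_add, star_ket, mulVec_smul, mulVec_add, mulVec_sub,
    smul_dotProduct, dotProduct_smul, add_dotProduct, sub_dotProduct, dotProduct_add,
    dotProduct_sub, ket_dotProduct_mulVec_ket]
  simp [pauliString, Fin.prod_univ_four, singletExpectation]
  ring

lemma zeroS_expectation_re_pow_four (f : Fin 4 → Fin 4) :
    (star zeroS ⬝ᵥ (pauliString f).mulVec zeroS).re ^ 4 =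
      if f 0 = f 1 ∧ f 2 = f 3 then 1 else 0 := by
  rw [zeroS_expectation, singletExpectation_eq, singletExpectation_eq, ← Complex.ofReal_mul,
    Complex.ofReal_re]
  split_ifs <;> norm_num <;> tauto

lemma card_pairwise_equal :
    (Finset.univ.filter fun f : Fin 4 → Fin 4 => f 0 = f 1 ∧ f 2 = f 3).card = 16 := by
  decide +kernel

/-- the 2-stabilizer Rényi entropy of |0_s⟩ (with respect to the
4-qubit Pauli basis) vanishes. -/
theorem M2_zeroS : M2 zeroS = 0 := by
  simp only [M2, zeroS_expectation_re_pow_four, Finset.sum_boole, card_pairwise_equal]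
  norm_num
end
end

section
/- The 2-stabilizer Rényi entropy (with respect to the 4-qubit Pauli basis) of the logical intertwiner basis state |1_s⟩ equals log₂(9/5) ≈ 0.847997: M₂(|1_s⟩) = log₂(9/5). -/
open Matrix BigOperators

noncomputable section

/-- The Pauli matrices with entries in the Gaussian integers. -/
def gaussianPauli : Fin 4 → Fin 2 → Fin 2 → GaussianInt
  | 0 => !![1, 0; 0, 1]
  | 1 => !![0, 1; 1, 0]
  | 2 => !![0, ⟨0, -1⟩; ⟨0, 1⟩, 0]
  | 3 => !![1, 0; 0, -1]

/-- The basis strings in the support of `oneS`. -/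
def oneSSupport : Fin 6 → Fin 4 → Fin 2 :=
  ![![0,0,1,1], ![1,1,0,0], ![0,1,0,1], ![1,0,1,0], ![0,1,1,0], ![1,0,0,1]]

/-- The coefficients of `2√3 • oneS` on its support. -/
def oneSCoeff : Fin 6 → ℤ := ![2, 2, -1, -1, -1, -1]

/-- `12` times the expectation value of a Pauli string in the state `oneS`. -/
def oneSExpectation (f : Fin 4 → Fin 4) : GaussianInt :=
  ∑ i, ∑ j, oneSCoeff i * oneSCoeff j *
    ∏ k, gaussianPauli (f k) (oneSSupport i k) (oneSSupport j k)

lemma sum_oneSExpectation_re_pow_four :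
    ∑ f : Fin 4 → Fin 4, (oneSExpectation f).re ^ 4 = 184320 := by
  decide +kernel

lemma toComplex_gaussianPauli (a : Fin 4) (r c : Fin 2) :
    (gaussianPauli a r c : ℂ) = pauli a r c := by
  fin_cases a <;> fin_cases r <;> fin_cases c <;>
    simp [gaussianPauli, pauli, GaussianInt.toComplex_def]

lemma oneS_eq_sum :
    oneS = ((2 * Real.sqrt 3 : ℝ) : ℂ)⁻¹ •
      ∑ i, (oneSCoeff i : ℂ) • (Pi.single (oneSSupport i) 1 : (Fin 4 → Fin 2) → ℂ) := by
  simp only [oneS, ket_eq_single, Fin.sum_univ_six]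
  ext x
  simp [oneSCoeff, oneSSupport]
  ring

lemma star_dotProduct_mulVec_sum_single {ι κ : Type*} [Fintype ι] [Fintype κ] [DecidableEq κ]
    (M : Matrix κ κ ℂ) (b : ι → κ) (v : ι → ℂ) :
    star (∑ i, v i • (Pi.single (b i) 1 : κ → ℂ)) ⬝ᵥ
        M *ᵥ (∑ i, v i • (Pi.single (b i) 1 : κ → ℂ)) =
      ∑ i, ∑ j, star (v i) * v j * M (b i) (b j) := by
  simp only [star_sum, star_smul, Pi.star_single, star_one, sum_dotProduct, mulVec_sum,
    dotProduct_sum, mulVec_smul, smul_dotProduct, dotProduct_smul, single_one_dotProduct,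
    mulVec_single_one, smul_eq_mul, col_apply, Finset.mul_sum, mul_assoc, mul_left_comm (v _)]
  exact Finset.sum_comm

lemma oneS_expectation (f : Fin 4 → Fin 4) :
    star oneS ⬝ᵥ (pauliString f).mulVec oneS = ((12 : ℝ)⁻¹ : ℝ) * (oneSExpectation f : ℂ) := by
  have h : ((2 * Real.sqrt 3 : ℝ) : ℂ)⁻¹ * ((2 * Real.sqrt 3 : ℝ) : ℂ)⁻¹ = ((12 : ℝ)⁻¹ : ℝ) := by
    rw [← mul_inv, ← Complex.ofReal_mul, ← Complex.ofReal_inv, mul_mul_mul_comm,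
      Real.mul_self_sqrt (by norm_num)]
    norm_num
  rw [oneS_eq_sum, star_smul, mulVec_smul, smul_dotProduct, dotProduct_smul,
    star_dotProduct_mulVec_sum_single, smul_eq_mul, smul_eq_mul, ← mul_assoc, star_inv₀,
    Complex.star_def, Complex.conj_ofReal, h]
  simp [oneSExpectation, pauliString, toComplex_gaussianPauli]

/-- the 2-stabilizer Rényi entropy of |1_s⟩ equals log₂(9/5). -/
theorem M2_oneS : M2 oneS = Real.logb 2 (9 / 5) := by
  have h : ∑ f : Fin 4 → Fin 4, ((oneSExpectation f).re : ℝ) ^ 4 = 184320 := by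
    exact_mod_cast sum_oneSExpectation_re_pow_four
  simp only [M2, oneS_expectation, Complex.re_ofReal_mul, ← GaussianInt.intCast_re, mul_pow,
    ← Finset.mul_sum, h]
  rw [← Real.logb_inv]
  norm_num
end
end

section
/- The two eigenstates of the oriented volume operator of the quantum tetrahedron have equal 2-stabilizer Rényi entropy (with respect to the 4-qubit Pauli basis), namely M₂(|V₊⟩) = M₂(|V₋⟩) = log₂(9/4) ≈ 1.16993. -/
open Matrix BigOperators

noncomputable section

/-- Volume eigenstate `|V₊⟩ = (1/√2)(|0_s⟩ − i|1_s⟩)`. -/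
def Vplus : (Fin 4 → Fin 2) → ℂ :=
  ((Real.sqrt 2 : ℂ))⁻¹ • (zeroS - Complex.I • oneS)

/-- Volume eigenstate `|V₋⟩ = (1/√2)(|0_s⟩ + i|1_s⟩)`. -/
def Vminus : (Fin 4 → Fin 2) → ℂ :=
  ((Real.sqrt 2 : ℂ))⁻¹ • (zeroS + Complex.I • oneS)

/-- The ring `ℤ[√3][i]`, in which the amplitudes of `√24 |V₊⟩` and the Pauli entries live. -/
abbrev AmpRing : Type := QuadraticAlgebra (ℤ√3) (-1) 0

/-- The embedding `ℤ[√3] → ℝ` sending `√3` to the chosen root `s` of `3`. -/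
def realEmb (s : ℝ) (hs : s * s = 3) : ℤ√3 →+* ℝ :=
  Zsqrtd.lift ⟨s, by simpa using hs⟩

/-- The embedding `ℤ[√3][i] → ℂ` sending `√3` to `s` and `i` to `i`. -/
def complexEmb (s : ℝ) (hs : s * s = 3) : AmpRing →+* ℂ where
  toFun z := ⟨realEmb s hs z.re, realEmb s hs z.im⟩
  map_one' := by apply Complex.ext <;> simp [QuadraticAlgebra.re_one, QuadraticAlgebra.im_one]
  map_zero' := by apply Complex.ext <;> simp
  map_add' x y := by simp [Complex.ext_iff]
  map_mul' x y := by
    apply Complex.ext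
    · simp
      ring
    · simp

/-- The Pauli matrices over `ℤ[√3][i]`. -/
def pauliAmp : Fin 4 → Fin 2 → Fin 2 → AmpRing
  | 0 => ![![1, 0], ![0, 1]]
  | 1 => ![![0, 1], ![1, 0]]
  | 2 => ![![0, ⟨0, -1⟩], ![⟨0, 1⟩, 0]]
  | 3 => ![![1, 0], ![0, -1]]

/-- The computational basis strings of Hamming weight two. -/
def supp : Fin 6 → Fin 4 → Fin 2 :=
  ![![0,1,0,1], ![1,0,1,0], ![0,1,1,0], ![1,0,0,1], ![0,0,1,1], ![1,1,0,0]]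

/-- The amplitudes of `√24 |V₊⟩` on `supp`. -/
def amp : Fin 6 → AmpRing :=
  ![⟨⟨0, 1⟩, 1⟩, ⟨⟨0, 1⟩, 1⟩, ⟨⟨0, -1⟩, 1⟩, ⟨⟨0, -1⟩, 1⟩, ⟨0, -2⟩, ⟨0, -2⟩]

/-- The complex conjugates of `amp`. -/
def ampConj : Fin 6 → AmpRing := fun j => ⟨(amp j).re, -(amp j).im⟩

/-- Whether a Pauli matrix flips the bit it acts on. -/
def pauliFlip : Fin 4 → Fin 2 := ![0, 1, 1, 0]

/-- The expectation value of a Pauli string in the unnormalized state `∑ j, amp j |supp j⟩`,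
summed over the nonvanishing matrix elements. -/
def expectAmp (f : Fin 4 → Fin 4) : AmpRing :=
  ∑ j, ∑ k, if ∀ l, supp j l = supp k l + pauliFlip (f l) then
    ampConj j * amp k * ∏ l, pauliAmp (f l) (supp j l) (supp k l) else 0

theorem pauliAmp_eq_zero {a : Fin 4} {r c : Fin 2} (h : r ≠ c + pauliFlip a) :
    pauliAmp a r c = 0 := by
  revert a r c
  decide

theorem expectAmp_eq (f : Fin 4 → Fin 4) :
    expectAmp f =
      ∑ j, ∑ k, ampConj j * amp k * ∏ l, pauliAmp (f l) (supp j l) (supp k l) := by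
  refine Finset.sum_congr rfl fun j _ => Finset.sum_congr rfl fun k _ => ?_
  split_ifs with h
  · rfl
  · push Not at h
    obtain ⟨l, hl⟩ := h
    rw [Finset.prod_eq_zero (Finset.mem_univ l) (pauliAmp_eq_zero hl), mul_zero]

theorem sum_expectAmp_re_pow_four :
    ∑ f : Fin 4 → Fin 4, (expectAmp f).re ^ 4 = 2359296 := by
  rw [← Equiv.sum_comp (finFunctionFinEquiv (m := 4) (n := 4)).symm]
  decide +kernel

theorem pauli_eq_complexEmb (s : ℝ) (hs : s * s = 3) (a : Fin 4) (r c : Fin 2) :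
    pauli a r c = complexEmb s hs (pauliAmp a r c) := by
  fin_cases a <;> fin_cases r <;> fin_cases c <;>
    simp [pauli, pauliAmp, complexEmb, Complex.ext_iff, QuadraticAlgebra.re_one,
      QuadraticAlgebra.im_one]

theorem star_complexEmb_amp (s : ℝ) (hs : s * s = 3) (j : Fin 6) :
    star (complexEmb s hs (amp j)) = complexEmb s hs (ampConj j) := by
  simp [complexEmb, ampConj, Complex.ext_iff]

theorem expectation_sum_ket {n : ℕ} {ι : Type*} [Fintype ι] (a : ι → ℂ)
    (b : ι → Fin n → Fin 2) (A : Matrix (Fin n → Fin 2) (Fin n → Fin 2) ℂ) :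
    star (∑ j, a j • ket (b j)) ⬝ᵥ A.mulVec (∑ j, a j • ket (b j)) =
      ∑ j, ∑ k, star (a j) * a k * A (b j) (b k) := by
  have hket : ∀ v : Fin n → Fin 2, ket v = Pi.single v 1 := by
    intro v
    ext i
    simp [ket, Pi.single_apply]
  simp only [hket, star_sum, star_smul, Matrix.mulVec_sum, sum_dotProduct,
    Matrix.mulVec_smul, smul_dotProduct, ← Pi.single_star, star_one,
    Matrix.mulVec_single_one]
  simp only [dotProduct_sum, dotProduct_smul, single_one_dotProduct, Matrix.col_apply,
    smul_eq_mul, Finset.mul_sum, mul_assoc]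

theorem M2_of_amp (s : ℝ) (hs : s * s = 3) (c : ℝ) (hc : c ^ 2 = 24⁻¹)
    {ψ : (Fin 4 → Fin 2) → ℂ}
    (hψ : ψ = ∑ j, ((c : ℂ) * complexEmb s hs (amp j)) • ket (supp j)) :
    M2 ψ = Real.logb 2 (9 / 4) := by
  have hexp : ∀ f : Fin 4 → Fin 4,
      (star ψ ⬝ᵥ (pauliString f).mulVec ψ).re = 24⁻¹ * realEmb s hs (expectAmp f).re := by
    intro f
    have h : star ψ ⬝ᵥ (pauliString f).mulVec ψ =
        ((c ^ 2 : ℝ) : ℂ) * complexEmb s hs (expectAmp f) := by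
      rw [hψ, expectation_sum_ket]
      simp only [expectAmp_eq, map_sum, map_mul, map_prod, Finset.mul_sum, pauliString,
        Matrix.of_apply, pauli_eq_complexEmb s hs, star_mul', star_complexEmb_amp]
      refine Finset.sum_congr rfl fun j _ => Finset.sum_congr rfl fun k _ => ?_
      simp
      ring
    rw [h, hc, Complex.re_ofReal_mul]
    rfl
  have hsum : ∑ f : Fin 4 → Fin 4, realEmb s hs (expectAmp f).re ^ 4 = 2359296 := by
    simp only [← map_pow, ← map_sum, sum_expectAmp_re_pow_four, map_ofNat]
  simp only [M2, hexp, mul_pow, ← Finset.mul_sum, hsum]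
  rw [← Real.logb_inv]
  norm_num

/-- the two volume eigenstates have equal 2-stabilizer Rényi entropy,
M₂(|V₊⟩) = M₂(|V₋⟩) = log₂(9/4). -/
theorem M2_volume_eigenstates :
    M2 Vplus = Real.logb 2 (9 / 4) ∧ M2 Vminus = Real.logb 2 (9 / 4) := by
  have h3 : √3 * √3 = (3 : ℝ) := by norm_num
  have h2 : √2 * √2 = (2 : ℝ) := by norm_num
  have hc : ((√2)⁻¹ * (√3)⁻¹ * 2⁻¹) ^ 2 = (24⁻¹ : ℝ) := by
    rw [mul_pow, mul_pow, inv_pow, inv_pow, sq √2, sq √3, h2, h3]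
    norm_num
  have hemb : ∀ (s : ℝ) (hs : s * s = 3) (z : AmpRing), complexEmb s hs z =
      (z.re.re + z.re.im * s) + (z.im.re + z.im.im * s) * Complex.I := by
    intro s hs z
    apply Complex.ext <;> simp [complexEmb, realEmb]
  constructor
  · refine M2_of_amp √3 h3 _ hc ?_
    funext i
    simp [hemb, Fin.sum_univ_six, amp, supp, Vplus, zeroS, oneS]
    field_simp
    ring
  · refine M2_of_amp (-√3) (by simp) (-((√2)⁻¹ * (√3)⁻¹ * 2⁻¹))
      (by rw [neg_sq, hc]) ?_
    funext i
    simp [hemb, Fin.sum_univ_six, amp, supp, Vminus, zeroS, oneS]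
    field_simp
    ring
end
end

section
/- The two volume eigenstates |V₊⟩ and |V₋⟩ of the quantum tetrahedron belong to the same Clifford orbit: there exist a unitary C on (ℂ²)^⊗4 belonging to the 4-qubit Clifford group (i.e., for every Pauli string P ∈ 𝒫₄ there exist a Pauli string P' ∈ 𝒫₄ and a phase z ∈ {1, −1, i, −i} with C P C† = z P') and a complex number w with |w| = 1 such that C|V₊⟩ = w|V₋⟩. -/
open Matrix BigOperators

noncomputable section

/-- `C` belongs to the 4-qubit Clifford group: it is unitary and conjugates every Pauli
string into a Pauli string up to a phase in {1, −1, i, −i}. -/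
def IsClifford4 (C : Matrix (Fin 4 → Fin 2) (Fin 4 → Fin 2) ℂ) : Prop :=
  C ∈ Matrix.unitaryGroup (Fin 4 → Fin 2) ℂ ∧
    ∀ f : Fin 4 → Fin 4, ∃ g : Fin 4 → Fin 4, ∃ z : ℂ,
      (z = 1 ∨ z = -1 ∨ z = Complex.I ∨ z = -Complex.I) ∧
      C * pauliString f * Cᴴ = z • pauliString g

/-- The unitary permuting tensor factors: `(qubitPerm σ v) i = v (i ∘ σ)`. -/
def qubitPerm {n : ℕ} (σ : Equiv.Perm (Fin n)) :
    Matrix (Fin n → Fin 2) (Fin n → Fin 2) ℂ :=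
  Matrix.of fun r c => if r ∘ σ = c then 1 else 0

theorem qubitPerm_mulVec {n : ℕ} (σ : Equiv.Perm (Fin n)) (v : (Fin n → Fin 2) → ℂ)
    (r : Fin n → Fin 2) : (qubitPerm σ).mulVec v r = v (r ∘ σ) := by
  simp [qubitPerm, Matrix.mulVec, dotProduct]

theorem qubitPerm_conj_apply {n : ℕ} (σ : Equiv.Perm (Fin n))
    (A : Matrix (Fin n → Fin 2) (Fin n → Fin 2) ℂ) (r c : Fin n → Fin 2) :
    (qubitPerm σ * A * (qubitPerm σ)ᴴ) r c = A (r ∘ σ) (c ∘ σ) := by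
  simp [qubitPerm, Matrix.mul_apply, apply_ite]

theorem qubitPerm_mem_unitaryGroup {n : ℕ} (σ : Equiv.Perm (Fin n)) :
    qubitPerm σ ∈ Matrix.unitaryGroup (Fin n → Fin 2) ℂ := by
  rw [Matrix.mem_unitaryGroup_iff, Matrix.star_eq_conjTranspose]
  ext r c
  have h := qubitPerm_conj_apply σ 1 r c
  rw [Matrix.mul_one] at h
  simp only [h, Matrix.one_apply, σ.surjective.injective_comp_right.eq_iff]

theorem qubitPerm_conj_pauliString {n : ℕ} (σ : Equiv.Perm (Fin n)) (f : Fin n → Fin 4) :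
    qubitPerm σ * pauliString f * (qubitPerm σ)ᴴ = pauliString (f ∘ σ.symm) := by
  ext r c
  rw [qubitPerm_conj_apply]
  simpa [pauliString] using
    Equiv.prod_comp σ fun k => pauli (f (σ.symm k)) (r k) (c k)

theorem qubitPerm_mulVec_ket {n : ℕ} (σ : Equiv.Perm (Fin n)) (b : Fin n → Fin 2) :
    (qubitPerm σ).mulVec (ket b) = ket (b ∘ σ.symm) := by
  ext r
  rw [qubitPerm_mulVec]
  simp only [ket, Equiv.eq_comp_symm]

/-- |V₊⟩ and |V₋⟩ belong to the same Clifford orbit: there are a 4-qubit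
Clifford unitary C and a phase w with C|V₊⟩ = w|V₋⟩. -/
theorem volume_eigenstates_same_clifford_orbit :
    ∃ C : Matrix (Fin 4 → Fin 2) (Fin 4 → Fin 2) ℂ, IsClifford4 C ∧
      ∃ w : ℂ, ‖w‖ = 1 ∧ C.mulVec Vplus = w • Vminus := by
  refine ⟨qubitPerm (Equiv.swap 0 1), ⟨qubitPerm_mem_unitaryGroup _, fun f =>
    ⟨f ∘ (Equiv.swap 0 1).symm, 1, Or.inl rfl, ?_⟩⟩, -1, by simp, ?_⟩
  · rw [qubitPerm_conj_pauliString, one_smul]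
  · have swap_comp (a b c d : Fin 2) :
        ![a, b, c, d] ∘ (Equiv.swap (0 : Fin 4) 1).symm = ![b, a, c, d] := by
      ext k
      fin_cases k <;> rfl
    simp only [Vplus, Vminus, zeroS, oneS, Matrix.mulVec_smul, Matrix.mulVec_sub,
      Matrix.mulVec_add, qubitPerm_mulVec_ket, swap_comp]
    module
end
end

section
/- The logical intertwiner basis state |0_s⟩ is a 4-qubit stabilizer state: there exist a unitary C on (ℂ²)^⊗4 belonging to the 4-qubit Clifford group (i.e., for every Pauli string P ∈ 𝒫₄ there exist a Pauli string P' ∈ 𝒫₄ and a phase z ∈ {1, −1, i, −i} with C P C† = z P') and a complex number w with |w| = 1 such that C|0000⟩ = w|0_s⟩. -/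
open Matrix BigOperators

noncomputable section

open scoped Kronecker

/-- Splitting four qubits into the first two and the last two. -/
@[simps]
def pairsEquiv (α : Type*) : (Fin 4 → α) ≃ (α × α) × (α × α) where
  toFun b := ((b 0, b 1), (b 2, b 3))
  invFun p := ![p.1.1, p.1.2, p.2.1, p.2.2]
  left_inv b := by ext k; fin_cases k <;> rfl
  right_inv _ := rfl

lemma pauliString_eq_kronecker (f : Fin 4 → Fin 4) :
    pauliString f =
      ((pauli (f 0) ⊗ₖ pauli (f 1)) ⊗ₖ (pauli (f 2) ⊗ₖ pauli (f 3))).submatrix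
        (pairsEquiv _) (pairsEquiv _) := by
  ext r c
  simp [pauliString, Fin.prod_univ_four, mul_assoc]

/-- The product `HX` of the Hadamard and the Pauli `X` gate, up to the phase `(1 + i) / √2`. -/
def hadamardX : Matrix (Fin 2) (Fin 2) ℂ :=
  ((1 + Complex.I) / 2) • !![1, 1; -1, 1]

lemma norm_sq_one_add_I_div_two :
    (1 + Complex.I) / 2 * star ((1 + Complex.I) / 2) = (2 : ℂ)⁻¹ := by
  rw [show star ((1 + Complex.I) / 2) = (1 - Complex.I) / 2 by
    simp [Complex.ext_iff]]
  linear_combination (-1 / 4 : ℂ) * Complex.I_sq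

lemma hadamardX_conj (M : Matrix (Fin 2) (Fin 2) ℂ) :
    hadamardX * M * hadamardXᴴ = (2 : ℂ)⁻¹ • (!![1, 1; -1, 1] * M * !![1, -1; 1, 1]) := by
  have h : (!![1, 1; -1, 1] : Matrix (Fin 2) (Fin 2) ℂ)ᴴ = !![1, -1; 1, 1] := by
    ext i j
    fin_cases i <;> fin_cases j <;> simp
  rw [hadamardX, Matrix.conjTranspose_smul, h, Matrix.smul_mul, Matrix.smul_mul, Matrix.mul_smul,
    smul_smul, norm_sq_one_add_I_div_two]

lemma hadamardX_mul_conjTranspose : hadamardX * hadamardXᴴ = 1 := by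
  have h := hadamardX_conj 1
  rw [Matrix.mul_one, Matrix.mul_one] at h
  rw [h]
  ext i j
  fin_cases i <;> fin_cases j <;> simp <;> norm_num

lemma hadamardX_conj_pauli (a : Fin 4) :
    ∃ b : Fin 4, ∃ z : ℂ, (z = 1 ∨ z = -1) ∧ hadamardX * pauli a * hadamardXᴴ = z • pauli b := by
  refine ⟨![0, 3, 2, 1] a, ![1, 1, 1, -1] a, by fin_cases a <;> simp, ?_⟩
  rw [hadamardX_conj]
  ext i j
  fin_cases a <;> fin_cases i <;> fin_cases j <;>
    simp [pauli] <;> ring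

lemma pauli_one_mul_conjTranspose : pauli 1 * (pauli 1)ᴴ = 1 := by
  ext i j
  fin_cases i <;> fin_cases j <;> simp [pauli, Matrix.mul_apply]

lemma pauli_one_conj_pauli (a : Fin 4) :
    ∃ b : Fin 4, ∃ z : ℂ, (z = 1 ∨ z = -1) ∧ pauli 1 * pauli a * (pauli 1)ᴴ = z • pauli b := by
  refine ⟨a, ![1, 1, -1, -1] a, by fin_cases a <;> simp, ?_⟩
  ext i j
  fin_cases a <;> fin_cases i <;> fin_cases j <;> simp [pauli, Matrix.mul_apply]

/-- The permutation of the two-qubit computational basis given by the CNOT gate. -/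
@[simps]
def cnot : Fin 2 × Fin 2 ≃ Fin 2 × Fin 2 where
  toFun p := (p.1, p.2 + p.1)
  invFun p := (p.1, p.2 + p.1)
  left_inv := by decide
  right_inv := by decide

lemma cnot_conj_pauli (a b : Fin 4) :
    ∃ c d : Fin 4, ∃ z : ℂ, (z = 1 ∨ z = -1) ∧
      (pauli a ⊗ₖ pauli b).submatrix cnot cnot = z • (pauli c ⊗ₖ pauli d) := by
  refine ⟨![![0, 0, 3, 3], ![1, 1, 2, 2], ![2, 2, 1, 1], ![3, 3, 0, 0]] a b,
    ![![0, 1, 2, 3], ![1, 0, 3, 2], ![1, 0, 3, 2], ![0, 1, 2, 3]] a b,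
    ![![1, 1, 1, 1], ![1, 1, 1, -1], ![1, 1, -1, 1], ![1, 1, 1, 1]] a b, ?_, ?_⟩
  · fin_cases a <;> fin_cases b <;> simp
  · ext ⟨i, j⟩ ⟨k, l⟩
    fin_cases a <;> fin_cases b <;> fin_cases i <;> fin_cases j <;> fin_cases k <;>
      fin_cases l <;> simp [pauli]

/-- The two-qubit gate `CNOT (HX ⊗ X)`, up to a phase. It sends `|00⟩` to the singlet state. -/
def singletGate : Matrix (Fin 2 × Fin 2) (Fin 2 × Fin 2) ℂ :=
  (hadamardX ⊗ₖ pauli 1).submatrix cnot (Equiv.refl _)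

lemma singletGate_mul_conjTranspose : singletGate * singletGateᴴ = 1 := by
  rw [singletGate, Matrix.conjTranspose_submatrix, Matrix.submatrix_mul_equiv,
    Matrix.conjTranspose_kronecker, ← Matrix.mul_kronecker_mul, hadamardX_mul_conjTranspose,
    pauli_one_mul_conjTranspose, Matrix.one_kronecker_one, Matrix.submatrix_one_equiv]

lemma singletGate_conj_pauli (a b : Fin 4) :
    ∃ c d : Fin 4, ∃ z : ℂ, (z = 1 ∨ z = -1) ∧
      singletGate * (pauli a ⊗ₖ pauli b) * singletGateᴴ = z • (pauli c ⊗ₖ pauli d) := by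
  obtain ⟨a', z₁, hz₁, h₁⟩ := hadamardX_conj_pauli a
  obtain ⟨b', z₂, hz₂, h₂⟩ := pauli_one_conj_pauli b
  obtain ⟨c, d, z₃, hz₃, h₃⟩ := cnot_conj_pauli a' b'
  refine ⟨c, d, z₁ * z₂ * z₃, ?_, ?_⟩
  · rcases hz₁ with rfl | rfl <;> rcases hz₂ with rfl | rfl <;> rcases hz₃ with rfl | rfl <;> simp
  · have h : singletGate * (pauli a ⊗ₖ pauli b) * singletGateᴴ =
        ((hadamardX * pauli a * hadamardXᴴ) ⊗ₖ (pauli 1 * pauli b * (pauli 1)ᴴ)).submatrix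
          cnot cnot := by
      rw [Matrix.mul_kronecker_mul, Matrix.mul_kronecker_mul, ← Matrix.conjTranspose_kronecker,
        ← Matrix.submatrix_mul_equiv _ _ _ (Equiv.refl _),
        ← Matrix.submatrix_mul_equiv _ _ _ (Equiv.refl _)]
      rfl
    rw [h, h₁, h₂, Matrix.smul_kronecker, Matrix.kronecker_smul, smul_smul, ← smul_smul _ z₃, ← h₃]
    rfl

/-- Two copies of `singletGate`, acting on the first and on the last pair of qubits. -/
def singletPairGate : Matrix (Fin 4 → Fin 2) (Fin 4 → Fin 2) ℂ :=
  (singletGate ⊗ₖ singletGate).submatrix (pairsEquiv _) (pairsEquiv _)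

lemma isClifford4_singletPairGate : IsClifford4 singletPairGate := by
  refine ⟨?_, fun f => ?_⟩
  · rw [Matrix.mem_unitaryGroup_iff, Matrix.star_eq_conjTranspose, singletPairGate,
      Matrix.conjTranspose_submatrix, Matrix.submatrix_mul_equiv, Matrix.conjTranspose_kronecker,
      ← Matrix.mul_kronecker_mul, singletGate_mul_conjTranspose, Matrix.one_kronecker_one,
      Matrix.submatrix_one_equiv]
  · obtain ⟨c, d, z, hz, h⟩ := singletGate_conj_pauli (f 0) (f 1)
    obtain ⟨c', d', z', hz', h'⟩ := singletGate_conj_pauli (f 2) (f 3)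
    refine ⟨![c, d, c', d'], z * z', ?_, ?_⟩
    · rcases hz with rfl | rfl <;> rcases hz' with rfl | rfl <;> simp
    · rw [pauliString_eq_kronecker, pauliString_eq_kronecker, singletPairGate,
        Matrix.conjTranspose_submatrix, Matrix.submatrix_mul_equiv, Matrix.submatrix_mul_equiv,
        Matrix.conjTranspose_kronecker, ← Matrix.mul_kronecker_mul, ← Matrix.mul_kronecker_mul,
        h, h', Matrix.smul_kronecker, Matrix.kronecker_smul, smul_smul]
      rfl

lemma singletGate_apply_zero (p : Fin 2 × Fin 2) :
    singletGate p (0, 0) =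
      (1 + Complex.I) / 2 * (if p = (0, 1) then 1 else if p = (1, 0) then -1 else 0) := by
  obtain ⟨a, b⟩ := p
  fin_cases a <;> fin_cases b <;> simp [singletGate, hadamardX, pauli]

lemma singletPairGate_mulVec_ket_zero :
    singletPairGate.mulVec (ket ![0, 0, 0, 0]) = Complex.I • zeroS := by
  ext i
  obtain ⟨⟨⟨a, b⟩, c, d⟩, rfl⟩ := (pairsEquiv (Fin 2)).symm.surjective i
  have h : (1 + Complex.I) / 2 * ((1 + Complex.I) / 2) = Complex.I * 2⁻¹ := by
    linear_combination (1 / 4 : ℂ) * Complex.I_sq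
  have hcol : singletPairGate.mulVec (ket ![0, 0, 0, 0]) ((pairsEquiv _).symm ((a, b), c, d)) =
      singletGate (a, b) (0, 0) * singletGate (c, d) (0, 0) := by
    simp [Matrix.mulVec, dotProduct, ket, singletPairGate]
  rw [hcol, singletGate_apply_zero, singletGate_apply_zero, mul_mul_mul_comm, h]
  fin_cases a <;> fin_cases b <;> fin_cases c <;> fin_cases d <;>
    simp [zeroS, ket, Equiv.symm_apply_eq]

/-- |0_s⟩ is a 4-qubit stabilizer state: there are a 4-qubit Clifford
unitary C and a phase w with C|0000⟩ = w|0_s⟩. -/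
theorem zeroS_is_stabilizer_state :
    ∃ C : Matrix (Fin 4 → Fin 2) (Fin 4 → Fin 2) ℂ, IsClifford4 C ∧
      ∃ w : ℂ, ‖w‖ = 1 ∧ C.mulVec (ket ![0,0,0,0]) = w • zeroS :=
  ⟨singletPairGate, isClifford4_singletPairGate, Complex.I, Complex.norm_I,
    singletPairGate_mulVec_ket_zero⟩
end
end

section
/- The volume eigenstates of the quantum tetrahedron are entangled with respect to the 4-qubit tensor product structure: there do not exist vectors u₁, u₂, u₃, u₄ ∈ ℂ² with |V₊⟩ = u₁⊗u₂⊗u₃⊗u₄, and likewise there do not exist vectors u₁, u₂, u₃, u₄ ∈ ℂ² with |V₋⟩ = u₁⊗u₂⊗u₃⊗u₄. -/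
open Matrix BigOperators

noncomputable section

/-- The elementary tensor `u₁⊗u₂⊗u₃⊗u₄` of four single-qubit vectors, as a vector of
`(ℂ²)^⊗4` realized as functions `(Fin 4 → Fin 2) → ℂ`. -/
def tensor4 (u : Fin 4 → (Fin 2 → ℂ)) : (Fin 4 → Fin 2) → ℂ :=
  fun i => ∏ k, u k (i k)

/-- Exchanging the first two qubits between `|0011⟩` and `|1100⟩` preserves the product of the
amplitudes of an elementary tensor. -/
lemma tensor4_mul_tensor4 (u : Fin 4 → (Fin 2 → ℂ)) :
    tensor4 u ![0,0,1,1] * tensor4 u ![1,1,0,0] =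
      tensor4 u ![0,0,0,0] * tensor4 u ![1,1,1,1] := by
  simp [tensor4, Fin.prod_univ_four]
  ring

/-- A vector with no `|0000⟩` amplitude but with `|0011⟩` and `|1100⟩` amplitudes is entangled. -/
lemma ne_tensor4_of_apply {v : (Fin 4 → Fin 2) → ℂ} (h0 : v ![0,0,0,0] = 0)
    (h1 : v ![0,0,1,1] ≠ 0) (h2 : v ![1,1,0,0] ≠ 0) (u : Fin 4 → (Fin 2 → ℂ)) :
    v ≠ tensor4 u := by
  rintro rfl
  exact mul_ne_zero h1 h2 (by rw [tensor4_mul_tensor4, h0, zero_mul])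

/-- the volume eigenstates |V₊⟩ and |V₋⟩ are entangled, i.e. neither is an
elementary tensor product of four single-qubit vectors. -/
theorem volume_eigenstates_entangled :
    (¬ ∃ u₁ u₂ u₃ u₄ : Fin 2 → ℂ, Vplus = tensor4 ![u₁, u₂, u₃, u₄]) ∧
    (¬ ∃ u₁ u₂ u₃ u₄ : Fin 2 → ℂ, Vminus = tensor4 ![u₁, u₂, u₃, u₄]) := by
  constructor
  · rintro ⟨u₁, u₂, u₃, u₄, h⟩
    refine ne_tensor4_of_apply ?_ ?_ ?_ _ h <;> simp [Vplus, zeroS, oneS, ket]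
  · rintro ⟨u₁, u₂, u₃, u₄, h⟩
    refine ne_tensor4_of_apply ?_ ?_ ?_ _ h <;> simp [Vminus, zeroS, oneS, ket]
end
end

section
/- For any dimension d ≥ 1, any k ≥ 1, and any unit vector ψ ∈ ℂ^d, the Haar average over the unitary group U(d) of the k-fold tensor power of the pure state Uψψ†U† equals the normalized projector onto the symmetric subspace: ∫_{U(d)} (U ψψ† U†)^{⊗k} dμ(U) = C(d+k−1, k)⁻¹ · (1/k!) Σ_{π ∈ S_k} T_π, where μ is the Haar probability measure on U(d). -/
open Matrix MeasureTheory BigOperators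

noncomputable section

attribute [local instance] Matrix.normedAddCommGroup Matrix.normedSpace

/-- Borel measurable structure on the unitary group `U(ι)`. -/
instance (ι : Type*) [Fintype ι] [DecidableEq ι] :
    MeasurableSpace (Matrix.unitaryGroup ι ℂ) := borel _

instance (ι : Type*) [Fintype ι] [DecidableEq ι] :
    BorelSpace (Matrix.unitaryGroup ι ℂ) := ⟨rfl⟩

/-- The pure state (rank-one orthogonal projector) `|v⟩⟨v| = v v†` associated to a vector. -/
def pureState {ι : Type*} (v : ι → ℂ) : Matrix ι ι ℂ :=
  Matrix.vecMulVec v (star v)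

/-- The `k`-fold tensor (Kronecker) power `A^{⊗k}` of a matrix, acting on
`(ℂ^ι)^{⊗k}` realized as functions `(Fin k → ι) → ℂ`. -/
def kronPow {ι : Type*} (k : ℕ) (A : Matrix ι ι ℂ) :
    Matrix (Fin k → ι) (Fin k → ι) ℂ :=
  Matrix.of fun r c => ∏ i, A (r i) (c i)

/-- The permutation operator `T_π` on `(ℂ^ι)^{⊗k}`, permuting tensor factors:
its matrix entries are `T_π(f, g) = 1` if `f = g ∘ π⁻¹` and `0` otherwise. -/
def permOp {ι : Type*} [DecidableEq ι] (k : ℕ) (π : Equiv.Perm (Fin k)) :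
    Matrix (Fin k → ι) (Fin k → ι) ℂ :=
  Matrix.of fun r c => if r = c ∘ ⇑π⁻¹ then 1 else 0

section HaarMoments

variable {ι : Type*} [Fintype ι] [DecidableEq ι]

instance compactSpace_unitaryGroup : CompactSpace (Matrix.unitaryGroup ι ℂ) := by
  refine (isCompact_iff_compactSpace (s := (Matrix.unitaryGroup ι ℂ : Set (Matrix ι ι ℂ)))).mp ?_
  have : ProperSpace (Matrix ι ι ℂ) := FiniteDimensional.proper ℂ _
  refine (isCompact_closedBall (0 : Matrix ι ι ℂ) 1).of_isClosed_subset ?_ fun U hU ↦ ?_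
  · have : (Matrix.unitaryGroup ι ℂ : Set (Matrix ι ι ℂ)) = {A | A * star A = 1} := by
      ext A
      exact Matrix.mem_unitaryGroup_iff
    rw [this]
    exact isClosed_eq (by fun_prop) continuous_const
  · simpa using entrywise_sup_norm_bound_of_unitary hU

/-- A continuous function on the unitary group is integrable for a finite measure. -/
lemma integrable_unitaryGroup_of_continuous {E : Type*} [NormedAddCommGroup E]
    (μ : Measure (Matrix.unitaryGroup ι ℂ)) [IsFiniteMeasure μ]
    {f : Matrix.unitaryGroup ι ℂ → E} (hf : Continuous f) : Integrable f μ :=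
  hf.integrable_of_hasCompactSupport (HasCompactSupport.of_compactSpace f)

/-- A finite family of complex coefficients is determined by the even polynomial
it defines on real points. -/
lemma coeff_eq_zero_of_sum_even_monomials_eq_zero (S : Finset (ι → ℕ)) (A : (ι → ℕ) → ℂ)
    (h : ∀ s : ι → ℝ, ∑ a ∈ S, A a * ∏ j, (s j : ℂ) ^ (2 * a j) = 0) :
    ∀ a ∈ S, A a = 0 := by
  let e : (ι → ℕ) → ι →₀ ℕ := fun a ↦ Finsupp.equivFunOnFinite.symm fun j ↦ 2 * a j
  have he : Function.Injective e := fun a b hab ↦ by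
    funext j
    have := DFunLike.congr_fun hab j
    simpa [e] using this
  let p : MvPolynomial ι ℂ := ∑ a ∈ S, MvPolynomial.monomial (e a) (A a)
  have hp : p = 0 := by
    refine MvPolynomial.funext_set (fun _ ↦ Set.range ((↑) : ℝ → ℂ))
      (fun _ ↦ Set.infinite_range_of_injective Complex.ofReal_injective) fun x hx ↦ ?_
    choose s hs using fun i ↦ hx i (Set.mem_univ i)
    obtain rfl : (fun i ↦ (s i : ℂ)) = x := funext hs
    simp only [p, map_sum, MvPolynomial.eval_monomial, map_zero]
    rw [← h s]
    refine Finset.sum_congr rfl fun a _ ↦ ?_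
    rw [Finsupp.prod_fintype _ _ (by simp)]
    simp [e]
  intro a ha
  have := congrArg (MvPolynomial.coeff (e a)) hp
  simpa [p, MvPolynomial.coeff_sum, MvPolynomial.coeff_monomial, he.eq_iff, ha] using this

/-- Every real unit vector is a row of some unitary matrix. -/
lemma exists_unitary_row_eq (s : ι → ℝ) (hs : ∑ j, s j ^ 2 = 1) (i : ι) :
    ∃ W : Matrix.unitaryGroup ι ℂ, ∀ j, (W : Matrix ι ι ℂ) i j = s j := by
  let w : EuclideanSpace ℂ ι := WithLp.toLp 2 fun j ↦ (s j : ℂ)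
  have hw : ‖w‖ = 1 := by
    rw [EuclideanSpace.norm_eq]
    simp [w, hs]
  have hv : Orthonormal ℂ (({i} : Set ι).domRestrict fun _ ↦ w) := by
    refine ⟨fun _ ↦ hw, fun x y hxy ↦ (hxy (Subsingleton.elim x y)).elim⟩
  obtain ⟨b, hb⟩ := hv.exists_orthonormalBasis_extension_of_card_eq (by simp)
  refine ⟨⟨_, Unitary.star_mem
    ((EuclideanSpace.basisFun ι ℂ).toMatrix_orthonormalBasis_mem_unitary b)⟩, fun j ↦ ?_⟩
  simp [Matrix.star_apply, Module.Basis.toMatrix_apply, hb i rfl, w]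

variable (μ : Measure (Matrix.unitaryGroup ι ℂ)) (ψ : ι → ℂ)

/-- The mixed moment `∫ (Uψ)^a conj(Uψ)^b`, in multi-index notation. -/
def haarMoment (a b : ι → ℕ) : ℂ :=
  ∫ U : Matrix.unitaryGroup ι ℂ,
    (∏ j, ((U : Matrix ι ι ℂ) *ᵥ ψ) j ^ a j) * ∏ j, star (((U : Matrix ι ι ℂ) *ᵥ ψ) j) ^ b j ∂μ

lemma continuous_mulVec_apply (j : ι) :
    Continuous fun U : Matrix.unitaryGroup ι ℂ ↦ ((U : Matrix ι ι ℂ) *ᵥ ψ) j :=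
  (continuous_apply j).comp (continuous_subtype_val.matrix_mulVec continuous_const)

lemma integrable_moment [IsFiniteMeasure μ] (a b : ι → ℕ) :
    Integrable (fun U : Matrix.unitaryGroup ι ℂ ↦ (∏ j, ((U : Matrix ι ι ℂ) *ᵥ ψ) j ^ a j) *
      ∏ j, star (((U : Matrix ι ι ℂ) *ᵥ ψ) j) ^ b j) μ := by
  have := continuous_mulVec_apply ψ
  exact integrable_unitaryGroup_of_continuous μ (by fun_prop)

lemma integral_comp_mulVec_mulVec [μ.IsMulLeftInvariant] (g : (ι → ℂ) → ℂ)
    (W : Matrix.unitaryGroup ι ℂ) :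
    ∫ U : Matrix.unitaryGroup ι ℂ, g ((W : Matrix ι ι ℂ) *ᵥ ((U : Matrix ι ι ℂ) *ᵥ ψ)) ∂μ =
      ∫ U : Matrix.unitaryGroup ι ℂ, g ((U : Matrix ι ι ℂ) *ᵥ ψ) ∂μ := by
  rw [← integral_mul_left_eq_self (fun U : Matrix.unitaryGroup ι ℂ ↦
    g ((U : Matrix ι ι ℂ) *ᵥ ψ)) W]
  simp [Matrix.mulVec_mulVec]

/-- Moments with different holomorphic and antiholomorphic degrees vanish. -/
lemma haarMoment_eq_zero [μ.IsMulLeftInvariant] {a b : ι → ℕ} (hab : a ≠ b) :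
    haarMoment μ ψ a b = 0 := by
  obtain ⟨i, hi⟩ := Function.ne_iff.mp hab
  have hi' : (a i : ℂ) - b i ≠ 0 := sub_ne_zero.mpr (by exact_mod_cast hi)
  let θ : ℝ := Real.pi / (a i - b i)
  let z : ι → ℂ := Function.update 1 i (Complex.exp (θ * Complex.I))
  have hstar : star (Complex.exp (θ * Complex.I)) = Complex.exp (-(θ * Complex.I)) := by
    rw [Complex.star_def, ← Complex.exp_conj]
    simp
  have hz : ∀ j, z j * star (z j) = 1 := fun j ↦ by
    by_cases hj : j = i
    · subst hj
      simp only [z, Function.update_self, hstar]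
      rw [← Complex.exp_add, add_neg_cancel, Complex.exp_zero]
    · simp [z, hj]
  let W : Matrix.unitaryGroup ι ℂ := ⟨Matrix.diagonal z, by
    rw [Matrix.mem_unitaryGroup_iff, Matrix.star_eq_conjTranspose, Matrix.diagonal_conjTranspose,
      Matrix.diagonal_mul_diagonal, ← Matrix.diagonal_one]
    exact congrArg _ (funext hz)⟩
  have hphase : (∏ j, z j ^ a j) * ∏ j, star (z j) ^ b j = -1 := by
    have h1 : ∏ j, z j ^ a j = z i ^ a i := Fintype.prod_eq_single i fun j hj ↦ by simp [z, hj]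
    have h2 : ∏ j, star (z j) ^ b j = star (z i) ^ b i :=
      Fintype.prod_eq_single i fun j hj ↦ by simp [z, hj]
    rw [h1, h2]
    simp only [z, Function.update_self, hstar]
    rw [← Complex.exp_nat_mul, ← Complex.exp_nat_mul, ← Complex.exp_add, ← Complex.exp_pi_mul_I]
    congr 1
    simp only [θ]
    push_cast
    field_simp
    ring
  have h := integral_comp_mulVec_mulVec μ ψ
    (fun v ↦ (∏ j, v j ^ a j) * ∏ j, star (v j) ^ b j) W
  have h' : -haarMoment μ ψ a b = haarMoment μ ψ a b := by
    refine Eq.trans ?_ h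
    rw [haarMoment, ← integral_neg]
    refine integral_congr_ae (.of_forall fun U ↦ ?_)
    simp only [W, Matrix.mulVec_diagonal, star_mul', mul_pow, Finset.prod_mul_distrib]
    linear_combination (-(∏ j, ((U : Matrix ι ι ℂ) *ᵥ ψ) j ^ a j) *
      ∏ j, star (((U : Matrix ι ι ℂ) *ᵥ ψ) j) ^ b j) * hphase
  exact self_eq_neg.mp h'.symm

/-- Expansion of `∫ |⟨s, Uψ⟩|^{2k}` into diagonal moments, for real `s`. -/
lemma integral_linear_pow_eq_sum [IsFiniteMeasure μ] [μ.IsMulLeftInvariant] (k : ℕ) (s : ι → ℝ) :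
    ∫ U : Matrix.unitaryGroup ι ℂ, (∑ j, (s j : ℂ) * ((U : Matrix ι ι ℂ) *ᵥ ψ) j) ^ k *
        star (∑ j, (s j : ℂ) * ((U : Matrix ι ι ℂ) *ᵥ ψ) j) ^ k ∂μ =
      ∑ a ∈ Finset.univ.piAntidiag k, (Nat.multinomial Finset.univ a : ℂ) ^ 2 *
        haarMoment μ ψ a a * ∏ j, (s j : ℂ) ^ (2 * a j) := by
  have hexp : ∀ U : Matrix.unitaryGroup ι ℂ,
      (∑ j, (s j : ℂ) * ((U : Matrix ι ι ℂ) *ᵥ ψ) j) ^ k *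
        star (∑ j, (s j : ℂ) * ((U : Matrix ι ι ℂ) *ᵥ ψ) j) ^ k =
      ∑ a ∈ Finset.univ.piAntidiag k, ∑ b ∈ Finset.univ.piAntidiag k,
        ((Nat.multinomial Finset.univ a : ℂ) * (Nat.multinomial Finset.univ b : ℂ) *
          ((∏ j, (s j : ℂ) ^ a j) * ∏ j, (s j : ℂ) ^ b j)) *
        ((∏ j, ((U : Matrix ι ι ℂ) *ᵥ ψ) j ^ a j) *
          ∏ j, star (((U : Matrix ι ι ℂ) *ᵥ ψ) j) ^ b j) := fun U ↦ by
    simp only [star_sum, star_mul', Finset.sum_pow_eq_sum_piAntidiag, Finset.sum_mul_sum,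
      mul_pow, Finset.prod_mul_distrib, Complex.star_def, Complex.conj_ofReal]
    refine Finset.sum_congr rfl fun a _ ↦ Finset.sum_congr rfl fun b _ ↦ ?_
    ring
  simp_rw [hexp]
  rw [integral_finsetSum _ fun a _ ↦ integrable_finsetSum _ fun b _ ↦
    (integrable_moment μ ψ a b).const_mul _]
  refine Finset.sum_congr rfl fun a ha ↦ ?_
  rw [integral_finsetSum _ fun b _ ↦ (integrable_moment μ ψ a b).const_mul _,
    Finset.sum_eq_single_of_mem a ha fun b _ hba ↦ ?_]
  · rw [integral_const_mul, ← haarMoment, ← Finset.prod_mul_distrib]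
    simp_rw [← pow_add, ← two_mul]
    ring
  · rw [integral_const_mul, ← haarMoment, haarMoment_eq_zero μ ψ hba.symm, mul_zero]

/-- Unitary invariance: `∫ |⟨s, Uψ⟩|^{2k}` depends only on the length of the real vector `s`. -/
lemma exists_integral_linear_pow_eq [Nonempty ι] [μ.IsMulLeftInvariant] {k : ℕ} (hk : k ≠ 0) :
    ∃ c : ℂ, ∀ s : ι → ℝ,
      ∫ U : Matrix.unitaryGroup ι ℂ, (∑ j, (s j : ℂ) * ((U : Matrix ι ι ℂ) *ᵥ ψ) j) ^ k *
        star (∑ j, (s j : ℂ) * ((U : Matrix ι ι ℂ) *ᵥ ψ) j) ^ k ∂μ =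
      c * (∑ j, (s j : ℂ) ^ 2) ^ k := by
  let i : ι := Classical.arbitrary ι
  refine ⟨∫ U : Matrix.unitaryGroup ι ℂ, ((U : Matrix ι ι ℂ) *ᵥ ψ) i ^ k *
    star (((U : Matrix ι ι ℂ) *ᵥ ψ) i) ^ k ∂μ, fun s ↦ ?_⟩
  have hr0 : 0 ≤ ∑ j, s j ^ 2 := Finset.sum_nonneg fun j _ ↦ sq_nonneg _
  rcases hr0.eq_or_lt with h0 | hpos
  · have hs : ∀ j, s j = 0 := fun j ↦ by
      simpa using (Finset.sum_eq_zero_iff_of_nonneg fun j _ ↦ sq_nonneg (s j)).mp h0.symm j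
        (Finset.mem_univ j)
    simp [hs, hk]
  · set r : ℝ := √(∑ j, s j ^ 2) with hr
    have hr2 : r ^ 2 = ∑ j, s j ^ 2 := Real.sq_sqrt hr0
    have hrpos : 0 < r := Real.sqrt_pos.mpr hpos
    obtain ⟨W, hW⟩ := exists_unitary_row_eq (fun j ↦ s j / r)
      (by simp_rw [div_pow, ← Finset.sum_div, hr2]; exact div_self hpos.ne') i
    rw [← integral_comp_mulVec_mulVec μ ψ (fun v ↦ v i ^ k * star (v i) ^ k) W,
      ← integral_mul_const]
    refine integral_congr_ae (.of_forall fun U ↦ ?_)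
    have hlin : ∑ j, (s j : ℂ) * ((U : Matrix ι ι ℂ) *ᵥ ψ) j =
        r * ((W : Matrix ι ι ℂ) *ᵥ ((U : Matrix ι ι ℂ) *ᵥ ψ)) i := by
      have hrc : (r : ℂ) ≠ 0 := by exact_mod_cast hrpos.ne'
      rw [Matrix.mulVec, dotProduct, Finset.mul_sum]
      refine Finset.sum_congr rfl fun j _ ↦ ?_
      rw [hW]
      push_cast
      field_simp
    have hsq : ∑ j, (s j : ℂ) ^ 2 = (r : ℂ) ^ 2 := by exact_mod_cast hr2.symm
    simp only [hlin, hsq, star_mul', Complex.star_def, Complex.conj_ofReal]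
    ring

lemma card_piAntidiag_univ (k : ℕ) :
    ((Finset.univ : Finset ι).piAntidiag k).card = (Fintype.card ι + k - 1).choose k := by
  rw [← Sym.card_sym_eq_choose, ← Nat.card_eq_fintype_card,
    Nat.card_congr (Sym.equivNatSumOfFintype ι k),
    ← Nat.subtype_card (p := fun P : ι → ℕ ↦ ∑ i, P i = k) (Finset.univ.piAntidiag k) (by simp)]

/-- The multinomial-weighted diagonal moments of degree `k` sum to one for a unit vector. -/
lemma sum_multinomial_mul_haarMoment [IsProbabilityMeasure μ] (hψ : star ψ ⬝ᵥ ψ = 1) (k : ℕ) :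
    ∑ a ∈ Finset.univ.piAntidiag k, (Nat.multinomial Finset.univ a : ℂ) * haarMoment μ ψ a a
      = 1 := by
  have hnorm : ∀ U : Matrix.unitaryGroup ι ℂ,
      ∑ a ∈ Finset.univ.piAntidiag k, (Nat.multinomial Finset.univ a : ℂ) *
        ((∏ j, ((U : Matrix ι ι ℂ) *ᵥ ψ) j ^ a j) *
          ∏ j, star (((U : Matrix ι ι ℂ) *ᵥ ψ) j) ^ a j) = 1 := fun U ↦ by
    have h1 : ∑ j, ((U : Matrix ι ι ℂ) *ᵥ ψ) j * star (((U : Matrix ι ι ℂ) *ᵥ ψ) j) = 1 := by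
      have : star ((U : Matrix ι ι ℂ) *ᵥ ψ) ⬝ᵥ ((U : Matrix ι ι ℂ) *ᵥ ψ) = 1 := by
        rw [Matrix.star_mulVec, Matrix.dotProduct_mulVec, Matrix.vecMul_vecMul,
          ← Matrix.star_eq_conjTranspose, Matrix.mem_unitaryGroup_iff'.mp U.2, Matrix.vecMul_one,
          hψ]
      rw [← this, dotProduct]
      exact Finset.sum_congr rfl fun j _ ↦ mul_comm _ _
    rw [← one_pow k, ← h1, Finset.sum_pow_eq_sum_piAntidiag]
    simp_rw [mul_pow, Finset.prod_mul_distrib]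
  simp_rw [haarMoment, ← integral_const_mul]
  rw [← integral_finsetSum _ fun a _ ↦ (integrable_moment μ ψ a a).const_mul _]
  simp only [hnorm, integral_const, probReal_univ, one_smul]

/-- The diagonal moments of a Haar-random unit vector. -/
lemma multinomial_mul_haarMoment [Nonempty ι] [μ.IsMulLeftInvariant] [IsProbabilityMeasure μ]
    (hψ : star ψ ⬝ᵥ ψ = 1) {k : ℕ} (hk : k ≠ 0) {a : ι → ℕ} (ha : ∑ j, a j = k) :
    (Nat.multinomial Finset.univ a : ℂ) * haarMoment μ ψ a a =
      ((Nat.choose (Fintype.card ι + k - 1) k : ℂ))⁻¹ := by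
  obtain ⟨c, hc⟩ := exists_integral_linear_pow_eq μ ψ hk
  have hcoeff : ∀ a ∈ Finset.univ.piAntidiag k,
      (Nat.multinomial Finset.univ a : ℂ) * haarMoment μ ψ a a = c := by
    intro a ha
    have h := coeff_eq_zero_of_sum_even_monomials_eq_zero (Finset.univ.piAntidiag k)
      (fun a ↦ (Nat.multinomial Finset.univ a : ℂ) ^ 2 * haarMoment μ ψ a a -
        (Nat.multinomial Finset.univ a : ℂ) * c) (fun s ↦ ?_) a ha
    · have hne : (Nat.multinomial Finset.univ a : ℂ) ≠ 0 := by
        exact_mod_cast (Nat.multinomial_pos _ _).ne'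
      exact mul_left_cancel₀ hne (by linear_combination h)
    · simp_rw [sub_mul]
      rw [Finset.sum_sub_distrib, ← integral_linear_pow_eq_sum, hc,
        Finset.sum_pow_eq_sum_piAntidiag, Finset.mul_sum, sub_eq_zero]
      refine Finset.sum_congr rfl fun a _ ↦ ?_
      simp_rw [pow_mul]
      ring
  have hsum := sum_multinomial_mul_haarMoment μ ψ hψ k
  rw [Finset.sum_congr rfl hcoeff, Finset.sum_const, card_piAntidiag_univ, nsmul_eq_mul] at hsum
  rw [hcoeff a (by simpa using ha)]
  exact eq_inv_of_mul_eq_one_right hsum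

end HaarMoments

section Fibers

variable {ι : Type*} [DecidableEq ι] {k : ℕ}

/-- The size of the fiber of `r` over `j`. -/
def fiberCard (r : Fin k → ι) (j : ι) : ℕ := (Finset.univ.filter fun i ↦ r i = j).card

lemma prod_comp_eq_prod_pow_fiberCard [Fintype ι] {M : Type*} [CommMonoid M] (r : Fin k → ι)
    (f : ι → M) : ∏ i, f (r i) = ∏ j, f j ^ fiberCard r j := by
  rw [← Finset.prod_fiberwise' Finset.univ r f]
  simp [fiberCard]

lemma sum_fiberCard [Fintype ι] (r : Fin k → ι) : ∑ j, fiberCard r j = k := by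
  simpa [fiberCard] using (Finset.card_eq_sum_card_fiberwise (s := Finset.univ) (t := Finset.univ)
    (f := r) (by simp)).symm

lemma fiberCard_comp_perm (c : Fin k → ι) (π : Equiv.Perm (Fin k)) :
    fiberCard (c ∘ π) = fiberCard c := by
  funext j
  exact Finset.card_equiv π (by simp)

lemma exists_perm_of_fiberCard_eq {r c : Fin k → ι} (h : fiberCard r = fiberCard c) :
    ∃ π : Equiv.Perm (Fin k), r = c ∘ π := by
  have e : ∀ j, Nonempty ({i // r i = j} ≃ {i // c i = j}) := fun j ↦
    Fintype.card_eq.mp (by simpa [fiberCard, Fintype.card_subtype] using congrFun h j)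
  refine ⟨Equiv.ofFiberEquiv (f := r) (g := c) fun j ↦ (e j).some, ?_⟩
  funext i
  exact (Equiv.ofFiberEquiv_map _ i).symm

/-- The number of permutations carrying `c` to `r`. -/
lemma sum_permOp_apply [Fintype ι] (r c : Fin k → ι) :
    (∑ π : Equiv.Perm (Fin k), permOp k π) r c =
      if fiberCard r = fiberCard c then ((∏ j, (fiberCard r j).factorial : ℕ) : ℂ) else 0 := by
  rw [Matrix.sum_apply]
  simp only [permOp, Matrix.of_apply]
  split_ifs with h
  · obtain ⟨σ, rfl⟩ := exists_perm_of_fiberCard_eq h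
    have hstab := DomMulAct.stabilizer_card (c : Fin k → ι)
    rw [Finset.sum_boole, h]
    congr 1
    simp only [fiberCard, ← Fintype.card_subtype]
    rw [← hstab]
    refine Fintype.card_congr
      (((Equiv.mulLeft σ).trans (Equiv.inv _)).subtypeEquiv fun π ↦ ?_)
    simp only [Equiv.trans_apply, Equiv.coe_mulLeft, Equiv.inv_apply, _root_.mul_inv_rev,
      Equiv.Perm.coe_mul, ← Function.comp_assoc]
    exact eq_comm.trans (Equiv.comp_symm_eq σ _ _).symm
  · refine Finset.sum_eq_zero fun π _ ↦ if_neg fun hr ↦ h ?_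
    rw [hr, fiberCard_comp_perm]

end Fibers

/-- for any Haar probability measure on U(d) and any unit vector ψ ∈ ℂ^d,
the Haar average of `(Uψψ†U†)^{⊗k}` is the normalized projector onto the symmetric
subspace: `C(d+k−1,k)⁻¹ · (1/k!) Σ_{π ∈ S_k} T_π`. -/
theorem haar_average_tensor_power_pure_state
    (d k : ℕ) (hd : 1 ≤ d) (hk : 1 ≤ k) (ψ : Fin d → ℂ) (hψ : star ψ ⬝ᵥ ψ = 1)
    (μ : Measure (Matrix.unitaryGroup (Fin d) ℂ)) [μ.IsHaarMeasure] [IsProbabilityMeasure μ] :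
    (∫ U : Matrix.unitaryGroup (Fin d) ℂ,
        kronPow k (pureState ((U : Matrix (Fin d) (Fin d) ℂ).mulVec ψ)) ∂μ) =
      ((Nat.choose (d + k - 1) k : ℂ))⁻¹ •
        ((Nat.factorial k : ℂ))⁻¹ • ∑ π : Equiv.Perm (Fin k), permOp k π := by
  have : Nonempty (Fin d) := ⟨⟨0, hd⟩⟩
  have hv := continuous_mulVec_apply (ι := Fin d) ψ
  have hcont : Continuous fun U : Matrix.unitaryGroup (Fin d) ℂ ↦
      kronPow k (pureState ((U : Matrix (Fin d) (Fin d) ℂ).mulVec ψ)) := by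
    refine continuous_matrix fun r c ↦ ?_
    simp only [kronPow, pureState, Matrix.of_apply, Matrix.vecMulVec_apply, Pi.star_apply]
    fun_prop
  ext r c
  have hentry := (Matrix.entryLinearMap ℂ ℂ r c).toContinuousLinearMap.integral_comp_comm
    (integrable_unitaryGroup_of_continuous μ hcont)
  refine hentry.symm.trans ?_
  change ∫ U : Matrix.unitaryGroup (Fin d) ℂ,
    kronPow k (pureState ((U : Matrix (Fin d) (Fin d) ℂ).mulVec ψ)) r c ∂μ = _
  simp only [kronPow, pureState, Matrix.of_apply, Matrix.vecMulVec_apply, Pi.star_apply,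
    Finset.prod_mul_distrib]
  have hmom : ∫ U : Matrix.unitaryGroup (Fin d) ℂ,
      (∏ i, ((U : Matrix (Fin d) (Fin d) ℂ) *ᵥ ψ) (r i)) *
        ∏ i, star (((U : Matrix (Fin d) (Fin d) ℂ) *ᵥ ψ) (c i)) ∂μ =
      haarMoment μ ψ (fiberCard r) (fiberCard c) := by
    refine integral_congr_ae (.of_forall fun U ↦ ?_)
    dsimp only
    rw [prod_comp_eq_prod_pow_fiberCard r, prod_comp_eq_prod_pow_fiberCard c fun j ↦
      star (((U : Matrix (Fin d) (Fin d) ℂ) *ᵥ ψ) j)]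
  rw [hmom, Matrix.smul_apply, Matrix.smul_apply, sum_permOp_apply]
  split_ifs with h
  · have hm := multinomial_mul_haarMoment μ ψ hψ (k := k) (by omega) (sum_fiberCard r)
    have hspec := Nat.multinomial_spec Finset.univ (fiberCard r)
    rw [sum_fiberCard] at hspec
    rw [← h, ← hspec]
    rw [Fintype.card_fin] at hm
    rw [← hm, smul_eq_mul, smul_eq_mul, Nat.cast_mul]
    have h1 : (Nat.multinomial Finset.univ (fiberCard r) : ℂ) ≠ 0 := by
      exact_mod_cast (Nat.multinomial_pos _ _).ne'
    have h2 : ((∏ j, (fiberCard r j).factorial : ℕ) : ℂ) ≠ 0 := by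
      exact_mod_cast (Finset.prod_pos fun j _ ↦ Nat.factorial_pos _).ne'
    field_simp
  · rw [haarMoment_eq_zero μ ψ h, smul_zero, smul_zero]
end
end

section
/- (Lemma 1) Let ℂ^d be decomposed as a subspace R of dimension d_R plus its orthogonal complement, with R the range of a linear isometry ι : ℂ^{d_R} → ℂ^d and Π_R = ι ι† the orthogonal projector onto R. Then for every k ≥ 1 and every unit vector ψ ∈ ℂ^{d_R}, the Haar average over U(d_R) of the k-fold tensor power of the pure state supported on R satisfies ∫_{U(d_R)} ( (ιUψ)(ιUψ)† )^{⊗k} dμ_{d_R}(U) = c_R(d, d_R) · Π_R^{⊗k} · ∫_{U(d)} ( (Vφ)(Vφ)† )^{⊗k} dμ_d(V), where φ = ιψ and c_R(d, d_R) = C(d+k−1, k) / C(d_R+k−1, k). -/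
open Matrix MeasureTheory BigOperators

noncomputable section

attribute [local instance] Matrix.normedAddCommGroup Matrix.normedSpace

section Combinatorics

variable {n : Type*} {k : ℕ}

/-- The multiset of values of an index tuple. -/
def tupleSym (r : Fin k → n) : Sym n k :=
  ⟨Finset.univ.val.map r, by simp⟩

theorem tupleSym_surjective : Function.Surjective (tupleSym : (Fin k → n) → Sym n k) := by
  rintro ⟨s, hs⟩
  induction s using Quotient.inductionOn with
  | h l =>
    obtain rfl : l.length = k := by simpa using hs
    refine ⟨l.get, Subtype.ext ?_⟩
    simp [tupleSym]

variable [DecidableEq n]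

theorem count_tupleSym (r : Fin k → n) (j : n) :
    Multiset.count j (tupleSym r : Multiset n) = (Finset.univ.filter fun i => r i = j).card := by
  change Multiset.count j (Finset.univ.val.map r) = _
  rw [Multiset.count_map, Finset.card_def, Finset.filter_val]
  simp only [eq_comm]

theorem tupleSym_comp_perm (r : Fin k → n) (σ : Equiv.Perm (Fin k)) :
    tupleSym (r ∘ σ) = tupleSym r := by
  refine Sym.coe_injective (Multiset.ext.2 fun j => ?_)
  rw [count_tupleSym, count_tupleSym]
  exact Finset.card_equiv σ (by simp)

theorem exists_perm_of_tupleSym_eq {r c : Fin k → n} (h : tupleSym r = tupleSym c) :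
    ∃ σ : Equiv.Perm (Fin k), r ∘ σ = c := by
  have e (j : n) : Nonempty ({i // c i = j} ≃ {i // r i = j}) := by
    rw [← Fintype.card_eq, Fintype.card_subtype, Fintype.card_subtype, ← count_tupleSym,
      ← count_tupleSym, h]
  exact ⟨Equiv.ofFiberEquiv fun j => (e j).some, funext (Equiv.ofFiberEquiv_map _)⟩

/-- The number of permutations carrying the index tuple `r` to `c`. -/
def permCount (r c : Fin k → n) : ℕ :=
  (Finset.univ.filter fun σ : Equiv.Perm (Fin k) => r ∘ σ = c).card

theorem permCount_eq_zero {r c : Fin k → n} (h : tupleSym r ≠ tupleSym c) :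
    permCount r c = 0 := by
  rw [permCount, Finset.card_eq_zero, Finset.filter_eq_empty_iff]
  rintro σ - rfl
  exact h (tupleSym_comp_perm r σ).symm

theorem permCount_eq_self {r c : Fin k → n} (h : tupleSym r = tupleSym c) :
    permCount r c = permCount r r := by
  obtain ⟨τ, rfl⟩ := exists_perm_of_tupleSym_eq h
  refine Finset.card_equiv (Equiv.mulRight τ⁻¹) fun σ => ?_
  simp only [Finset.mem_filter_univ, Equiv.coe_mulRight, Equiv.Perm.coe_mul, ← Function.comp_assoc]
  constructor
  · intro h
    rw [h, Function.comp_assoc]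
    ext; simp
  · intro h
    nth_rewrite 2 [← h]
    ext; simp

variable [Fintype n]

/-- The number of index tuples with the same multiset of values as `r`. -/
def orbitCard (r : Fin k → n) : ℕ :=
  (Finset.univ.filter fun c : Fin k → n => tupleSym c = tupleSym r).card

theorem orbitCard_pos (r : Fin k → n) : 0 < orbitCard r :=
  Finset.card_pos.2 ⟨r, by simp⟩

theorem orbitCard_mul_permCount (r : Fin k → n) :
    orbitCard r * permCount r r = k.factorial := by
  have h : ∑ c : Fin k → n, permCount r c = k.factorial := by
    simp only [permCount]
    rw [← Finset.card_eq_sum_card_fiberwise (fun _ _ => Finset.mem_coe.2 (Finset.mem_univ _)),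
      Finset.card_univ, Fintype.card_perm, Fintype.card_fin]
  rw [← h, orbitCard, ← smul_eq_mul, ← Finset.sum_const, Finset.sum_filter]
  refine Finset.sum_congr rfl fun c _ => ?_
  split_ifs with hc
  · exact (permCount_eq_self hc.symm).symm
  · exact (permCount_eq_zero (Ne.symm hc)).symm

theorem sum_inv_orbitCard :
    ∑ r : Fin k → n, ((orbitCard r : ℂ))⁻¹ = (Fintype.card n + k - 1).choose k := by
  rw [← Sym.card_sym_eq_choose, ← Finset.sum_fiberwise Finset.univ tupleSym,
    Fintype.card_eq_sum_ones, Nat.cast_sum]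
  refine Finset.sum_congr rfl fun s _ => ?_
  obtain ⟨r₀, rfl⟩ := tupleSym_surjective s
  have h : ∀ r ∈ Finset.univ.filter (fun r : Fin k → n => tupleSym r = tupleSym r₀),
      ((orbitCard r : ℂ))⁻¹ = (orbitCard r₀ : ℂ)⁻¹ := by
    intro r hr
    rw [Finset.mem_filter_univ] at hr
    simp only [orbitCard, hr]
  rw [Finset.sum_congr rfl h, Finset.sum_const, nsmul_eq_mul, Nat.cast_one]
  exact mul_inv_cancel₀ (Nat.cast_ne_zero.2 (orbitCard_pos r₀).ne')

end Combinatorics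

section Moments

variable {n : Type*} [Fintype n] [DecidableEq n] {k : ℕ}

instance : CompactSpace (Matrix.unitaryGroup n ℂ) := by
  have h : IsCompact (Set.univ.pi fun _ => Set.univ.pi fun _ => Metric.closedBall 0 1 :
      Set (n → n → ℂ)) :=
    isCompact_univ_pi fun _ => isCompact_univ_pi fun _ => isCompact_closedBall 0 1
  refine isCompact_iff_compactSpace.1 (h.of_isClosed_subset
    (isClosed_unitary (R := Matrix n n ℂ)) fun U hU i _ j _ => ?_)
  rw [mem_closedBall_zero_iff]
  exact entry_norm_bound_of_unitary hU i j

theorem continuous_unitary_mulVec (φ : n → ℂ) (i : n) :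
    Continuous fun V : Matrix.unitaryGroup n ℂ => ((V : Matrix n n ℂ) *ᵥ φ) i :=
  (continuous_apply i).comp (continuous_subtype_val.matrix_mulVec continuous_const)

theorem integrable_of_continuous_unitaryGroup {E : Type*} [NormedAddCommGroup E]
    (μ : Measure (Matrix.unitaryGroup n ℂ)) [IsFiniteMeasure μ] {f : Matrix.unitaryGroup n ℂ → E}
    (hf : Continuous f) : Integrable f μ :=
  hf.integrable_of_hasCompactSupport (HasCompactSupport.of_compactSpace f)

theorem exp_I_pow_mul_star_pow_ne_one {a b : ℕ} (h : a ≠ b) :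
    Complex.exp Complex.I ^ a * star (Complex.exp Complex.I) ^ b ≠ 1 := by
  have hs : star (Complex.exp Complex.I) = Complex.exp (-Complex.I) := by
    rw [Complex.star_def, ← Complex.exp_conj, Complex.conj_I]
  rw [hs, ← Complex.exp_nat_mul, ← Complex.exp_nat_mul, ← Complex.exp_add, Ne,
    Complex.exp_eq_one_iff]
  rintro ⟨m, hm⟩
  have h1 : ((a : ℂ) - b) = m * (2 * Real.pi) := by
    apply mul_right_cancel₀ Complex.I_ne_zero
    linear_combination hm
  have h2 : ((a : ℝ) - b) = m * (2 * Real.pi) := by exact_mod_cast h1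
  have hm0 : m ≠ 0 := by
    rintro rfl
    apply h
    have : (a : ℝ) = b := by simpa [sub_eq_zero] using h2
    exact_mod_cast this
  have hm0' : (m : ℝ) ≠ 0 := Int.cast_ne_zero.2 hm0
  refine irrational_pi ⟨((a : ℚ) - b) / (2 * m), ?_⟩
  push_cast
  field_simp
  linear_combination h2

theorem exists_unitary_row (y : n → ℂ) (hy : star y ⬝ᵥ y = 1) (e : n) :
    ∃ W : Matrix.unitaryGroup n ℂ, ∀ j, (W : Matrix n n ℂ) e j = y j := by
  have hv : Orthonormal ℂ (({e} : Set n).domRestrict fun _ => WithLp.toLp 2 y) := by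
    rw [orthonormal_iff_ite]
    rintro ⟨i, rfl⟩ ⟨j, rfl⟩
    rw [if_pos rfl]
    simpa only [Set.domRestrict_apply, EuclideanSpace.inner_eq_star_dotProduct,
      dotProduct_comm] using hy
  obtain ⟨b, hb⟩ := hv.exists_orthonormalBasis_extension_of_card_eq (by simp)
  refine ⟨⟨Matrix.of fun i j => b i j, ?_⟩, fun j => ?_⟩
  · rw [Matrix.mem_unitaryGroup_iff]
    ext i j
    have h := orthonormal_iff_ite.1 b.orthonormal j i
    rw [EuclideanSpace.inner_eq_star_dotProduct] at h
    simpa [Matrix.one_apply, eq_comm, Matrix.mul_apply, dotProduct] using h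
  · simp [hb e rfl]

/-- The mixed moments of the entries of `V φ` for `V` distributed according to `μ`. -/
def unitaryMoment (μ : Measure (Matrix.unitaryGroup n ℂ)) (φ : n → ℂ) (r c : Fin k → n) : ℂ :=
  ∫ V, ∏ i, (((V : Matrix n n ℂ) *ᵥ φ) (r i) * star (((V : Matrix n n ℂ) *ᵥ φ) (c i))) ∂μ

variable (μ : Measure (Matrix.unitaryGroup n ℂ)) (φ : n → ℂ)

theorem continuous_unitaryMoment_integrand (r c : Fin k → n) :
    Continuous fun V : Matrix.unitaryGroup n ℂ =>
      ∏ i, (((V : Matrix n n ℂ) *ᵥ φ) (r i) * star (((V : Matrix n n ℂ) *ᵥ φ) (c i))) :=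
  continuous_finsetProd _ fun i _ =>
    (continuous_unitary_mulVec φ (r i)).mul (continuous_unitary_mulVec φ (c i)).star

theorem integral_kronPow_pureState_apply [IsFiniteMeasure μ] {m : Type*} [Fintype m]
    {v : Matrix.unitaryGroup n ℂ → m → ℂ} (hv : ∀ j, Continuous fun V => v V j)
    (r c : Fin k → m) :
    (∫ V, kronPow k (pureState (v V)) ∂μ) r c =
      ∫ V, ∏ i, (v V (r i) * star (v V (c i))) ∂μ := by
  have hc (r c : Fin k → m) : Integrable (fun V => kronPow k (pureState (v V)) r c) μ :=
    integrable_of_continuous_unitaryGroup μ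
      (continuous_finsetProd Finset.univ fun i _ => (hv (r i)).fun_mul (hv (c i)).star)
  exact (congrFun (eval_integral (f := fun V => kronPow k (pureState (v V)))
    (fun r => Integrable.of_eval (hc r)) r) c).trans
    (eval_integral (f := fun V => kronPow k (pureState (v V)) r) (hc r) c)

theorem integral_prod_mulVec [IsFiniteMeasure μ] {m : Type*}
    (E : Matrix m n ℂ) (r c : Fin k → m) :
    ∫ V : Matrix.unitaryGroup n ℂ, ∏ i, ((E *ᵥ ((V : Matrix n n ℂ) *ᵥ φ)) (r i) *
      star ((E *ᵥ ((V : Matrix n n ℂ) *ᵥ φ)) (c i))) ∂μ =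
    ∑ a : Fin k → n, ∑ b : Fin k → n,
      (∏ i, E (r i) (a i)) * (∏ i, star (E (c i) (b i))) * unitaryMoment μ φ a b := by
  have h (V : Matrix.unitaryGroup n ℂ) :
      ∏ i, ((E *ᵥ ((V : Matrix n n ℂ) *ᵥ φ)) (r i) *
        star ((E *ᵥ ((V : Matrix n n ℂ) *ᵥ φ)) (c i))) =
      ∑ a : Fin k → n, ∑ b : Fin k → n, (∏ i, E (r i) (a i)) * (∏ i, star (E (c i) (b i))) *
        ∏ i, (((V : Matrix n n ℂ) *ᵥ φ) (a i) * star (((V : Matrix n n ℂ) *ᵥ φ) (b i))) := by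
    generalize (V : Matrix n n ℂ) *ᵥ φ = v
    simp only [Matrix.mulVec, dotProduct, Finset.prod_mul_distrib, star_sum, Fintype.prod_sum,
      star_mul']
    rw [Finset.sum_mul_sum]
    refine Finset.sum_congr rfl fun a _ => Finset.sum_congr rfl fun b _ => ?_
    ring
  simp only [h]
  have hi (a b : Fin k → n) : Integrable (fun V : Matrix.unitaryGroup n ℂ =>
      (∏ i, E (r i) (a i)) * (∏ i, star (E (c i) (b i))) *
        ∏ i, (((V : Matrix n n ℂ) *ᵥ φ) (a i) * star (((V : Matrix n n ℂ) *ᵥ φ) (b i)))) μ :=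
    (integrable_of_continuous_unitaryGroup μ (continuous_unitaryMoment_integrand φ a b)).const_mul _
  rw [integral_finsetSum _ fun a _ => integrable_finsetSum _ fun b _ => hi a b]
  refine Finset.sum_congr rfl fun a _ => ?_
  rw [integral_finsetSum _ fun b _ => hi a b]
  exact Finset.sum_congr rfl fun b _ => integral_const_mul _ _

theorem unitaryMoment_comp_perm (r c : Fin k → n) (σ τ : Equiv.Perm (Fin k)) :
    unitaryMoment μ φ (r ∘ σ) (c ∘ τ) = unitaryMoment μ φ r c := by
  refine integral_congr_ae (.of_forall fun V => ?_)
  simp only [Finset.prod_mul_distrib, Function.comp_apply]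
  rw [Equiv.prod_comp σ fun i => ((V : Matrix n n ℂ) *ᵥ φ) (r i),
    Equiv.prod_comp τ fun i => star (((V : Matrix n n ℂ) *ᵥ φ) (c i))]

theorem sum_unitaryMoment_diag [IsProbabilityMeasure μ] (hφ : star φ ⬝ᵥ φ = 1) :
    ∑ r : Fin k → n, unitaryMoment μ φ r r = 1 := by
  have hV (V : Matrix.unitaryGroup n ℂ) : ∑ r : Fin k → n,
      ∏ i, (((V : Matrix n n ℂ) *ᵥ φ) (r i) * star (((V : Matrix n n ℂ) *ᵥ φ) (r i))) = 1 := by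
    rw [← Fintype.prod_sum fun (_ : Fin k) j =>
      ((V : Matrix n n ℂ) *ᵥ φ) j * star (((V : Matrix n n ℂ) *ᵥ φ) j)]
    refine Finset.prod_eq_one fun _ _ => ?_
    calc _ = star ((V : Matrix n n ℂ) *ᵥ φ) ⬝ᵥ ((V : Matrix n n ℂ) *ᵥ φ) := by
          simp [dotProduct, mul_comm]
      _ = 1 := by
          rw [Matrix.star_mulVec, Matrix.dotProduct_mulVec, Matrix.vecMul_vecMul,
            ← Matrix.star_eq_conjTranspose, Matrix.mem_unitaryGroup_iff'.1 V.2, Matrix.vecMul_one,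
            hφ]
  simp only [unitaryMoment]
  rw [← integral_finsetSum _ fun r _ =>
    integrable_of_continuous_unitaryGroup μ (continuous_unitaryMoment_integrand φ r r)]
  simp only [hV, integral_const, probReal_univ, one_smul]

theorem unitaryMoment_eq_self {r c : Fin k → n} (h : tupleSym r = tupleSym c) :
    unitaryMoment μ φ r c = unitaryMoment μ φ r r := by
  obtain ⟨σ, rfl⟩ := exists_perm_of_tupleSym_eq h
  exact unitaryMoment_comp_perm μ φ r r 1 σ

variable [μ.IsHaarMeasure]

theorem unitaryMoment_eq_integral_mul (W : Matrix.unitaryGroup n ℂ) (r c : Fin k → n) :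
    unitaryMoment μ φ r c = ∫ V : Matrix.unitaryGroup n ℂ,
      ∏ i, (((W : Matrix n n ℂ) *ᵥ ((V : Matrix n n ℂ) *ᵥ φ)) (r i) *
        star (((W : Matrix n n ℂ) *ᵥ ((V : Matrix n n ℂ) *ᵥ φ)) (c i))) ∂μ := by
  rw [unitaryMoment, ← integral_mul_left_eq_self _ W]
  simp only [Submonoid.coe_mul, Matrix.mulVec_mulVec]

theorem unitaryMoment_eq_zero {r c : Fin k → n} (h : tupleSym r ≠ tupleSym c) :
    unitaryMoment μ φ r c = 0 := by
  obtain ⟨j, hj⟩ : ∃ j, (Finset.univ.filter fun i => r i = j).card ≠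
      (Finset.univ.filter fun i => c i = j).card := by
    by_contra! hj
    refine h (Sym.coe_injective (Multiset.ext.2 fun j => ?_))
    rw [count_tupleSym, count_tupleSym, hj]
  set w : ℂ := Complex.exp Complex.I
  have hw : star w * w = 1 := by
    rw [Complex.star_def, ← Complex.exp_conj, Complex.conj_I, ← Complex.exp_add]
    simp
  let u : n → ℂ := fun l => if l = j then w else 1
  have hW : Matrix.diagonal u ∈ Matrix.unitaryGroup n ℂ := by
    rw [Matrix.mem_unitaryGroup_iff', Matrix.star_eq_conjTranspose, Matrix.diagonal_conjTranspose,
      Matrix.diagonal_mul_diagonal, ← Matrix.diagonal_one]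
    congr 1
    ext l
    by_cases hl : l = j <;> simp [u, hl]
    exact hw
  have key := unitaryMoment_eq_integral_mul μ φ ⟨_, hW⟩ r c
  have hu (s : Fin k → n) : ∏ i, u (s i) = w ^ (Finset.univ.filter fun i => s i = j).card := by
    simp [u, Finset.prod_ite]
  have hV (v : n → ℂ) : ∏ i, ((Matrix.diagonal u *ᵥ v) (r i) *
      star ((Matrix.diagonal u *ᵥ v) (c i))) =
      (w ^ (Finset.univ.filter fun i => r i = j).card *
        star w ^ (Finset.univ.filter fun i => c i = j).card) *
        ∏ i, (v (r i) * star (v (c i))) := by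
    rw [← star_pow, ← hu, ← hu]
    simp only [Matrix.mulVec_diagonal, star_mul', star_prod, Finset.prod_mul_distrib]
    ring
  simp only [hV] at key
  rw [integral_const_mul] at key
  by_contra h0
  exact exp_I_pow_mul_star_pow_ne_one hj (mul_right_cancel₀ h0 (key.symm.trans (one_mul _).symm))

theorem exists_sum_unitaryMoment_eq [IsFiniteMeasure μ] [Nonempty n] (k : ℕ) :
    ∃ K : ℂ, ∀ t : n → ℝ, (∀ j, 0 < t j) →
      ∑ a : Fin k → n, ∑ b : Fin k → n, ((∏ i, √(t (a i)) : ℝ) : ℂ) * ((∏ i, √(t (b i)) : ℝ) : ℂ) *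
        unitaryMoment μ φ a b = K * (∑ j, (t j : ℂ)) ^ k := by
  obtain ⟨e⟩ := ‹Nonempty n›
  refine ⟨unitaryMoment μ φ (fun _ : Fin k => e) fun _ => e, fun t ht => ?_⟩
  set s := ∑ j, t j with hs
  have hs0 : 0 < s := Finset.sum_pos (fun j _ => ht j) ⟨e, Finset.mem_univ e⟩
  have hss : ((√s : ℝ) : ℂ) * (√s : ℝ) = s := by
    rw [← Complex.ofReal_mul, Real.mul_self_sqrt hs0.le]
  have hsne : ((√s : ℝ) : ℂ) ≠ 0 := Complex.ofReal_ne_zero.2 (Real.sqrt_pos.2 hs0).ne'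
  obtain ⟨W, hW⟩ := exists_unitary_row (fun j => ((√(t j) / √s : ℝ) : ℂ)) (by
    have h (j : n) : ((√(t j) / √s : ℝ) : ℂ) * ((√(t j) / √s : ℝ) : ℂ) = ((t j / s : ℝ) : ℂ) := by
      rw [← Complex.ofReal_mul, div_mul_div_comm, Real.mul_self_sqrt (ht j).le,
        Real.mul_self_sqrt hs0.le]
    simp only [dotProduct, Pi.star_apply, Complex.star_def, Complex.conj_ofReal, h]
    rw [← Complex.ofReal_sum, ← Finset.sum_div, div_self hs0.ne', Complex.ofReal_one]) e
  have hW' (j : n) : ((√(t j) : ℝ) : ℂ) = (√s : ℝ) * (W : Matrix n n ℂ) e j := by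
    rw [hW, Complex.ofReal_div, mul_div_cancel₀ _ hsne]
  have hW'' (j : n) : ((√(t j) : ℝ) : ℂ) = (√s : ℝ) * star ((W : Matrix n n ℂ) e j) := by
    rw [hW, Complex.star_def, Complex.conj_ofReal, Complex.ofReal_div, mul_div_cancel₀ _ hsne]
  rw [unitaryMoment_eq_integral_mul μ φ W, integral_prod_mulVec, ← Complex.ofReal_sum, ← hs,
    Finset.sum_mul]
  refine Finset.sum_congr rfl fun a _ => ?_
  rw [Finset.sum_mul]
  refine Finset.sum_congr rfl fun b _ => ?_
  rw [Complex.ofReal_prod, Complex.ofReal_prod, Finset.prod_congr rfl fun i _ => hW' (a i),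
    Finset.prod_congr rfl fun i _ => hW'' (b i), Finset.prod_mul_distrib, Finset.prod_mul_distrib,
    Finset.prod_const, Finset.card_univ, Fintype.card_fin, ← hss]
  ring

theorem sum_sqrt_mul_unitaryMoment {t : n → ℝ} (ht : ∀ j, 0 < t j) (a : Fin k → n) :
    ∑ b : Fin k → n, ((∏ i, √(t (a i)) : ℝ) : ℂ) * ((∏ i, √(t (b i)) : ℝ) : ℂ) *
      unitaryMoment μ φ a b =
    (orbitCard a * unitaryMoment μ φ a a) * ∏ i, (t (a i) : ℂ) := by
  have h (b : Fin k → n) : ((∏ i, √(t (a i)) : ℝ) : ℂ) * ((∏ i, √(t (b i)) : ℝ) : ℂ) *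
      unitaryMoment μ φ a b =
      if tupleSym b = tupleSym a then unitaryMoment μ φ a a * ∏ i, (t (a i) : ℂ) else 0 := by
    split_ifs with hb
    · rw [unitaryMoment_eq_self μ φ hb.symm]
      obtain ⟨σ, rfl⟩ := exists_perm_of_tupleSym_eq hb.symm
      simp only [Function.comp_apply]
      rw [Equiv.prod_comp σ fun i => √(t (a i)), ← Complex.ofReal_mul, ← Finset.prod_mul_distrib,
        Finset.prod_congr rfl fun i _ => Real.mul_self_sqrt (ht (a i)).le, Complex.ofReal_prod,
        mul_comm]
    · rw [unitaryMoment_eq_zero μ φ (Ne.symm hb), mul_zero]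
  rw [Finset.sum_congr rfl fun b _ => h b, ← Finset.sum_filter, Finset.sum_const, orbitCard,
    nsmul_eq_mul, mul_assoc]

/-- Coefficients of a sum of monomials indexed by tuples, when they depend only on the multiset
of values. -/
theorem coeff_sum_prod_X {f : (Fin k → n) → ℂ}
    (hf : ∀ a b, tupleSym a = tupleSym b → f a = f b) (r : Fin k → n) :
    MvPolynomial.coeff (∑ i, Finsupp.single (r i) 1)
      (∑ a : Fin k → n, MvPolynomial.C (f a) * ∏ i, MvPolynomial.X (a i)) = orbitCard r * f r := by
  have hexp (a b : Fin k → n) : ∑ i, Finsupp.single (a i) 1 = ∑ i, Finsupp.single (b i) 1 ↔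
      tupleSym a = tupleSym b := by
    rw [← Sym.coe_inj, Multiset.ext, DFunLike.ext_iff]
    refine forall_congr' fun j => ?_
    rw [count_tupleSym, count_tupleSym]
    simp [Finsupp.finsetSum_apply, Finsupp.single_apply]
  have hX (a : Fin k → n) : ∏ i, (MvPolynomial.X (a i) : MvPolynomial n ℂ) =
      MvPolynomial.monomial (∑ i, Finsupp.single (a i) 1) 1 :=
    (MvPolynomial.monomial_sum_one _ _).symm
  have h (a : Fin k → n) : MvPolynomial.coeff (∑ i, Finsupp.single (r i) 1)
      (MvPolynomial.C (f a) * ∏ i, MvPolynomial.X (a i)) =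
      if tupleSym a = tupleSym r then f r else 0 := by
    rw [hX, MvPolynomial.coeff_C_mul, MvPolynomial.coeff_monomial]
    simp only [hexp]
    split_ifs with ha
    · rw [hf a r ha, mul_one]
    · rw [mul_zero]
  rw [MvPolynomial.coeff_sum, Finset.sum_congr rfl fun a _ => h a, ← Finset.sum_filter,
    Finset.sum_const, orbitCard, nsmul_eq_mul]

theorem exists_orbitCard_mul_unitaryMoment_eq [IsFiniteMeasure μ] [Nonempty n] (k : ℕ) :
    ∃ K : ℂ, ∀ r : Fin k → n, orbitCard r * unitaryMoment μ φ r r = K := by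
  obtain ⟨K, hK⟩ := exists_sum_unitaryMoment_eq μ φ k
  refine ⟨K, fun r => ?_⟩
  have hpoly : (∑ a : Fin k → n, MvPolynomial.C (orbitCard a * unitaryMoment μ φ a a) *
      ∏ i, MvPolynomial.X (a i) : MvPolynomial n ℂ) =
      ∑ a : Fin k → n, MvPolynomial.C K * ∏ i, MvPolynomial.X (a i) := by
    refine MvPolynomial.funext_set (fun _ => Complex.ofReal '' Set.Ioi 0)
      (fun _ => (Set.Ioi_infinite 0).image Complex.ofReal_injective.injOn) fun x hx => ?_
    choose t ht htx using fun j => hx j (Set.mem_univ j)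
    obtain rfl : (fun j => (t j : ℂ)) = x := funext htx
    simp only [map_sum, map_mul, map_prod, MvPolynomial.eval_C, MvPolynomial.eval_X]
    rw [← Finset.mul_sum, ← Fintype.sum_pow fun j => (t j : ℂ), ← hK t ht]
    exact Finset.sum_congr rfl fun a _ => (sum_sqrt_mul_unitaryMoment μ φ ht a).symm
  have hcoeff := congrArg (MvPolynomial.coeff (∑ i, Finsupp.single (r i) 1)) hpoly
  rw [coeff_sum_prod_X, coeff_sum_prod_X fun _ _ _ => rfl] at hcoeff
  · exact mul_left_cancel₀ (Nat.cast_ne_zero.2 (orbitCard_pos r).ne') hcoeff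
  · intro a b hab
    rw [← unitaryMoment_eq_self μ φ hab]
    obtain ⟨σ, rfl⟩ := exists_perm_of_tupleSym_eq hab
    simp only [orbitCard, tupleSym_comp_perm]
    rw [← unitaryMoment_comp_perm μ φ a (a ∘ σ) σ 1]
    rfl

theorem choose_mul_unitaryMoment [IsProbabilityMeasure μ] (hφ : star φ ⬝ᵥ φ = 1)
    (r c : Fin k → n) :
    ((Fintype.card n + k - 1).choose k : ℂ) * unitaryMoment μ φ r c =
      permCount r c / k.factorial := by
  have : Nonempty n := by
    by_contra hn
    rw [not_nonempty_iff] at hn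
    simp [dotProduct] at hφ
  obtain ⟨K, hK⟩ := exists_orbitCard_mul_unitaryMoment_eq μ φ k
  have hN (a : Fin k → n) : (orbitCard a : ℂ) ≠ 0 := Nat.cast_ne_zero.2 (orbitCard_pos a).ne'
  have hm (a : Fin k → n) : unitaryMoment μ φ a a = K * (orbitCard a : ℂ)⁻¹ := by
    rw [← hK a]
    field_simp [hN a]
  have hchoose : K * ((Fintype.card n + k - 1).choose k : ℂ) = 1 := by
    rw [← sum_inv_orbitCard, Finset.mul_sum, ← sum_unitaryMoment_diag (k := k) μ φ hφ]
    exact Finset.sum_congr rfl fun a _ => (hm a).symm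
  by_cases h : tupleSym r = tupleSym c
  · rw [unitaryMoment_eq_self μ φ h, permCount_eq_self h, hm, ← mul_assoc,
      mul_comm _ K, hchoose, one_mul, ← orbitCard_mul_permCount r, Nat.cast_mul]
    have hp : (permCount r r : ℂ) ≠ 0 := fun h0 => by
      have := orbitCard_mul_permCount r
      rw [Nat.cast_eq_zero.1 h0, mul_zero] at this
      exact k.factorial_ne_zero this.symm
    field_simp [hN r]
  · rw [unitaryMoment_eq_zero μ φ h, permCount_eq_zero h]
    simp

end Moments

theorem sum_prod_mul_permCount {m n : Type*} [Fintype m] [DecidableEq m] [Fintype n]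
    [DecidableEq n] {k : ℕ} (f : m → n → ℂ) (c : Fin k → m) (a : Fin k → n) :
    ∑ s : Fin k → m, (∏ i, f (s i) (a i)) * (permCount s c : ℂ) =
      ∑ b : Fin k → n, (∏ i, f (c i) (b i)) * (permCount a b : ℂ) := by
  simp only [permCount, Finset.card_filter, Nat.cast_sum, Finset.mul_sum]
  rw [Finset.sum_comm, Finset.sum_comm (s := Finset.univ (α := Fin k → n))]
  refine Finset.sum_congr rfl fun σ _ => ?_
  have h (s : Fin k → m) : s ∘ σ = c ↔ s = c ∘ σ.symm := (Equiv.eq_comp_symm σ s c).symm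
  simp only [h, Nat.cast_ite, Nat.cast_one, Nat.cast_zero, mul_ite, mul_one, mul_zero,
    Finset.sum_ite_eq, Finset.sum_ite_eq', Finset.mem_univ, if_true]
  rw [← Equiv.prod_comp σ]
  simp

/-- Lemma 1: let `ι : ℂ^{d_R} → ℂ^d` be a linear isometry (given by a
`d × d_R` matrix with `ι† ι = 1`), `Π_R = ι ι†` the orthogonal projector onto its range
`R`, and `φ = ι ψ` for a unit vector `ψ ∈ ℂ^{d_R}`. Then the Haar average over `U(d_R)`
of the `k`-th tensor power of the pure state supported on `R` equals
`c_R(d, d_R) · Π_R^{⊗k} · ∫_{U(d)} ((Vφ)(Vφ)†)^{⊗k} dμ_d(V)` with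
`c_R(d, d_R) = C(d+k−1, k) / C(d_R+k−1, k)`. -/
theorem haar_average_on_subspace
    (d dR k : ℕ) (hk : 1 ≤ k)
    (emb : Matrix (Fin d) (Fin dR) ℂ) (hemb : embᴴ * emb = 1)
    (ψ : Fin dR → ℂ) (hψ : star ψ ⬝ᵥ ψ = 1)
    (μR : Measure (Matrix.unitaryGroup (Fin dR) ℂ)) [μR.IsHaarMeasure] [IsProbabilityMeasure μR]
    (μd : Measure (Matrix.unitaryGroup (Fin d) ℂ)) [μd.IsHaarMeasure] [IsProbabilityMeasure μd] :
    (∫ U : Matrix.unitaryGroup (Fin dR) ℂ,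
        kronPow k (pureState (emb.mulVec ((U : Matrix (Fin dR) (Fin dR) ℂ).mulVec ψ))) ∂μR) =
      ((Nat.choose (d + k - 1) k : ℂ) / (Nat.choose (dR + k - 1) k : ℂ)) •
        (kronPow k (emb * embᴴ) *
          ∫ V : Matrix.unitaryGroup (Fin d) ℂ,
            kronPow k (pureState ((V : Matrix (Fin d) (Fin d) ℂ).mulVec (emb.mulVec ψ))) ∂μd) := by
  have hφ : star (emb *ᵥ ψ) ⬝ᵥ (emb *ᵥ ψ) = 1 := by
    rw [Matrix.star_mulVec, Matrix.dotProduct_mulVec, Matrix.vecMul_vecMul, hemb,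
      Matrix.vecMul_one, hψ]
  have hR := choose_mul_unitaryMoment (k := k) μR ψ hψ
  have hD := choose_mul_unitaryMoment (k := k) μd _ hφ
  rw [Fintype.card_fin] at hR hD
  have hdR : ((dR + k - 1).choose k : ℂ) ≠ 0 := by
    have : dR ≠ 0 := by
      rintro rfl
      simp [dotProduct] at hψ
    exact Nat.cast_ne_zero.2 (Nat.choose_pos (by omega)).ne'
  have hcont (j : Fin d) : Continuous fun U : Matrix.unitaryGroup (Fin dR) ℂ =>
      (emb *ᵥ ((U : Matrix (Fin dR) (Fin dR) ℂ) *ᵥ ψ)) j :=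
    (continuous_apply j).comp (continuous_const.matrix_mulVec
      (continuous_subtype_val.matrix_mulVec continuous_const))
  rw [div_eq_inv_mul, mul_smul, eq_inv_smul_iff₀ hdR]
  ext r c
  rw [Matrix.smul_apply, Matrix.smul_apply, Matrix.mul_apply,
    integral_kronPow_pureState_apply μR hcont,
    integral_prod_mulVec, smul_eq_mul, smul_eq_mul, Finset.mul_sum, Finset.mul_sum]
  have hL (a : Fin k → Fin dR) : ((dR + k - 1).choose k : ℂ) * ∑ b : Fin k → Fin dR,
      (∏ i, emb (r i) (a i)) * (∏ i, star (emb (c i) (b i))) * unitaryMoment μR ψ a b =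
      ∑ s : Fin k → Fin d, (∏ i, emb (r i) (a i)) * (∏ i, star (emb (s i) (a i))) *
        (permCount s c / k.factorial : ℂ) := by
    have h := sum_prod_mul_permCount (fun x y => star (emb x y)) c a
    calc _ = (∏ i, emb (r i) (a i)) / k.factorial *
          ∑ b : Fin k → Fin dR, (∏ i, star (emb (c i) (b i))) * permCount a b := by
          rw [Finset.mul_sum, Finset.mul_sum]
          refine Finset.sum_congr rfl fun b _ => ?_
          linear_combination (∏ i, emb (r i) (a i)) * (∏ i, star (emb (c i) (b i))) * hR a b
      _ = _ := by
          rw [← h, Finset.mul_sum]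
          refine Finset.sum_congr rfl fun s _ => ?_
          ring
  rw [Finset.sum_congr rfl fun a _ => hL a, Finset.sum_comm]
  refine Finset.sum_congr rfl fun s _ => ?_
  have hK : kronPow k (emb * embᴴ) r s =
      ∑ a : Fin k → Fin dR, (∏ i, emb (r i) (a i)) * ∏ i, star (emb (s i) (a i)) := by
    simp only [kronPow, Matrix.of_apply, Matrix.mul_apply, Matrix.conjTranspose_apply,
      Fintype.prod_sum, Finset.prod_mul_distrib]
  rw [integral_kronPow_pureState_apply μd (continuous_unitary_mulVec _), ← Finset.sum_mul, ← hK,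
    ← hD s c, unitaryMoment]
  ring
end
end

section
/- The average linear stabilizer entropy of a Haar-random single-qubit pure state, computed with respect to the single-qubit Pauli basis, equals 1/5: ∫_{U(2)} M_lin(U e₀) dμ(U) = 1/5, where e₀ is any fixed unit vector of ℂ² and μ is the Haar probability measure on U(2). -/
open Matrix MeasureTheory BigOperators

noncomputable section

/-- The linear stabilizer entropy of a single-qubit state with respect to the
single-qubit Pauli basis `𝒫₁ = {σ₀, σ₁, σ₂, σ₃}` (`d = 2`):
`M_lin(ψ) = 1 − d⁻¹ Σ_{P∈𝒫₁} ⟨ψ|P|ψ⟩⁴`. Since `⟨ψ|P|ψ⟩` is real for Hermitian `P`,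
we take its real part. -/
def MlinQubit (ψ : Fin 2 → ℂ) : ℝ :=
  1 - (2 : ℝ)⁻¹ * ∑ a : Fin 4, ((star ψ ⬝ᵥ (pauli a).mulVec ψ).re) ^ 4

/-- The expectation value `⟨ψ|σₐ|ψ⟩` of a Pauli matrix. -/
def pauliExpectation (a : Fin 4) (ψ : Fin 2 → ℂ) : ℝ :=
  (star ψ ⬝ᵥ (pauli a).mulVec ψ).re

theorem pauliExpectation_zero (ψ : Fin 2 → ℂ) :
    pauliExpectation 0 ψ = (star ψ ⬝ᵥ ψ).re := by
  simp [pauliExpectation, pauli]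

theorem pauliExpectation_one (ψ : Fin 2 → ℂ) :
    pauliExpectation 1 ψ = 2 * ((ψ 0).re * (ψ 1).re + (ψ 0).im * (ψ 1).im) := by
  simp [pauliExpectation, pauli, dotProduct, mulVec, Fin.sum_univ_two]; ring

theorem pauliExpectation_two (ψ : Fin 2 → ℂ) :
    pauliExpectation 2 ψ = 2 * ((ψ 0).re * (ψ 1).im - (ψ 0).im * (ψ 1).re) := by
  simp [pauliExpectation, pauli, dotProduct, mulVec, Fin.sum_univ_two]; ring

theorem pauliExpectation_three (ψ : Fin 2 → ℂ) :
    pauliExpectation 3 ψ =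
      (ψ 0).re ^ 2 + (ψ 0).im ^ 2 - (ψ 1).re ^ 2 - (ψ 1).im ^ 2 := by
  simp [pauliExpectation, pauli, dotProduct, mulVec, Fin.sum_univ_two]; ring

theorem pauliExpectation_sq_add_sq_add_sq {ψ : Fin 2 → ℂ} (hψ : star ψ ⬝ᵥ ψ = 1) :
    pauliExpectation 1 ψ ^ 2 + pauliExpectation 2 ψ ^ 2 + pauliExpectation 3 ψ ^ 2 = 1 := by
  have h : (ψ 0).re ^ 2 + (ψ 0).im ^ 2 + (ψ 1).re ^ 2 + (ψ 1).im ^ 2 = 1 := by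
    have := congrArg Complex.re hψ
    simp [dotProduct, Fin.sum_univ_two] at this
    linarith
  rw [pauliExpectation_one, pauliExpectation_two, pauliExpectation_three]
  calc _ = ((ψ 0).re ^ 2 + (ψ 0).im ^ 2 + (ψ 1).re ^ 2 + (ψ 1).im ^ 2) ^ 2 := by ring
    _ = 1 := by rw [h, one_pow]

theorem star_mulVec_dotProduct_mulVec_unitary {n : Type*} [Fintype n] [DecidableEq n]
    (U : unitaryGroup n ℂ) (ψ : n → ℂ) :
    star ((U : Matrix n n ℂ).mulVec ψ) ⬝ᵥ (U : Matrix n n ℂ).mulVec ψ = star ψ ⬝ᵥ ψ := by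
  have hU : (U : Matrix n n ℂ)ᴴ * (U : Matrix n n ℂ) = 1 := mem_unitaryGroup_iff'.1 U.2
  rw [star_mulVec, ← dotProduct_mulVec, mulVec_mulVec, hU, one_mulVec]

/-- The Clifford unitary of order three (up to phase) permuting the Pauli axes cyclically. -/
def axisCycle : unitaryGroup (Fin 2) ℂ :=
  ⟨!![⟨1 / 2, -1 / 2⟩, ⟨-1 / 2, -1 / 2⟩; ⟨1 / 2, -1 / 2⟩, ⟨1 / 2, 1 / 2⟩], by
    rw [mem_unitaryGroup_iff]
    ext i j
    fin_cases i <;> fin_cases j <;>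
      simp [Matrix.mul_apply, Fin.sum_univ_two, Complex.ext_iff] <;> norm_num⟩

theorem pauliExpectation_axisCycle (ψ : Fin 2 → ℂ) :
    pauliExpectation 1 ((axisCycle : Matrix (Fin 2) (Fin 2) ℂ).mulVec ψ) = pauliExpectation 3 ψ ∧
    pauliExpectation 2 ((axisCycle : Matrix (Fin 2) (Fin 2) ℂ).mulVec ψ) = pauliExpectation 1 ψ ∧
    pauliExpectation 3 ((axisCycle : Matrix (Fin 2) (Fin 2) ℂ).mulVec ψ) =
      pauliExpectation 2 ψ := by
  simp only [pauliExpectation_one, pauliExpectation_two, pauliExpectation_three]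
  refine ⟨?_, ?_, ?_⟩ <;>
    simp [axisCycle, mulVec, dotProduct, Fin.sum_univ_two] <;> ring

/-- The phase gate `diag(1, c + s i)`, rotating the Bloch sphere about the third axis. -/
def phaseGate (c s : ℝ) (h : c ^ 2 + s ^ 2 = 1) : unitaryGroup (Fin 2) ℂ :=
  ⟨!![1, 0; 0, ⟨c, s⟩], by
    rw [mem_unitaryGroup_iff]
    ext i j
    fin_cases i <;> fin_cases j <;>
      simp [Matrix.mul_apply, Fin.sum_univ_two, Complex.ext_iff]
    constructor <;> linarith⟩

theorem pauliExpectation_one_phaseGate {c s : ℝ} (h : c ^ 2 + s ^ 2 = 1) (ψ : Fin 2 → ℂ) :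
    pauliExpectation 1 ((phaseGate c s h : Matrix (Fin 2) (Fin 2) ℂ).mulVec ψ) =
      c * pauliExpectation 1 ψ - s * pauliExpectation 2 ψ := by
  simp only [pauliExpectation_one, pauliExpectation_two]
  simp [phaseGate, mulVec, dotProduct, Fin.sum_univ_two]
  ring

theorem continuous_pauliExpectation_mulVec (a : Fin 4) (ψ : Fin 2 → ℂ) :
    Continuous fun U : unitaryGroup (Fin 2) ℂ =>
      pauliExpectation a ((U : Matrix (Fin 2) (Fin 2) ℂ).mulVec ψ) := by
  unfold pauliExpectation
  fun_prop

theorem integral_comp_mulVec_unitary_mulVec {n : Type*} [Fintype n] [DecidableEq n]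
    (μ : Measure (unitaryGroup n ℂ)) [μ.IsMulLeftInvariant]
    (V : unitaryGroup n ℂ) (ψ : n → ℂ) (f : (n → ℂ) → ℝ) :
    ∫ U : unitaryGroup n ℂ, f ((V : Matrix n n ℂ).mulVec ((U : Matrix n n ℂ).mulVec ψ)) ∂μ =
      ∫ U : unitaryGroup n ℂ, f ((U : Matrix n n ℂ).mulVec ψ) ∂μ := by
  rw [← integral_mul_left_eq_self (fun U : unitaryGroup n ℂ => f ((U : Matrix n n ℂ).mulVec ψ)) V]
  simp [mulVec_mulVec]

theorem abs_pauliExpectation_le_one {ψ : Fin 2 → ℂ} (hψ : star ψ ⬝ᵥ ψ = 1) (a : Fin 4) :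
    |pauliExpectation a ψ| ≤ 1 := by
  have h := pauliExpectation_sq_add_sq_add_sq hψ
  rw [← sq_le_one_iff_abs_le_one]
  fin_cases a <;> dsimp only [Fin.isValue, Fin.zero_eta, Fin.mk_one, Fin.reduceFinMk]
  · rw [pauliExpectation_zero, hψ]; simp
  all_goals nlinarith [sq_nonneg (pauliExpectation 1 ψ), sq_nonneg (pauliExpectation 2 ψ),
    sq_nonneg (pauliExpectation 3 ψ)]

theorem integrable_pauliExpectation_pow_mul_pow {e₀ : Fin 2 → ℂ} (he₀ : star e₀ ⬝ᵥ e₀ = 1)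
    (μ : Measure (unitaryGroup (Fin 2) ℂ)) [IsFiniteMeasure μ] (a b : Fin 4) (k l : ℕ) :
    Integrable (fun U : unitaryGroup (Fin 2) ℂ =>
      pauliExpectation a ((U : Matrix (Fin 2) (Fin 2) ℂ).mulVec e₀) ^ k *
        pauliExpectation b ((U : Matrix (Fin 2) (Fin 2) ℂ).mulVec e₀) ^ l) μ := by
  refine Integrable.of_bound (C := 1) ?_ (.of_forall fun U => ?_)
  · exact (((continuous_pauliExpectation_mulVec a e₀).pow k).mul
      ((continuous_pauliExpectation_mulVec b e₀).pow l)).measurable.aestronglyMeasurable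
  · have hU := (star_mulVec_dotProduct_mulVec_unitary U e₀).trans he₀
    rw [Real.norm_eq_abs, abs_mul, abs_pow, abs_pow]
    exact mul_le_one₀ (pow_le_one₀ (abs_nonneg _) (abs_pauliExpectation_le_one hU a))
      (by positivity) (pow_le_one₀ (abs_nonneg _) (abs_pauliExpectation_le_one hU b))

/-- The fourth moment of a Bloch coordinate of a Haar-random state. -/
theorem integral_pauliExpectation_pow_four {e₀ : Fin 2 → ℂ} (he₀ : star e₀ ⬝ᵥ e₀ = 1)
    (μ : Measure (unitaryGroup (Fin 2) ℂ)) [μ.IsMulLeftInvariant] [IsProbabilityMeasure μ]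
    {a : Fin 4} (ha : a ≠ 0) :
    ∫ U : unitaryGroup (Fin 2) ℂ,
      pauliExpectation a ((U : Matrix (Fin 2) (Fin 2) ℂ).mulVec e₀) ^ 4 ∂μ = 1 / 5 := by
  let r (a : Fin 4) (U : unitaryGroup (Fin 2) ℂ) : ℝ :=
    pauliExpectation a ((U : Matrix (Fin 2) (Fin 2) ℂ).mulVec e₀)
  have hint (a b : Fin 4) (k l : ℕ) : Integrable (fun U => r a U ^ k * r b U ^ l) μ :=
    integrable_pauliExpectation_pow_mul_pow he₀ μ a b k l
  have hint4 (a : Fin 4) : Integrable (fun U => r a U ^ 4) μ := by simpa using hint a a 4 0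
  have h31 : ∫ U, r 3 U ^ 4 ∂μ = ∫ U, r 1 U ^ 4 ∂μ := by
    simpa only [pauliExpectation_axisCycle] using
      integral_comp_mulVec_unitary_mulVec μ axisCycle e₀ (fun ψ => pauliExpectation 1 ψ ^ 4)
  have h12 : ∫ U, r 1 U ^ 4 ∂μ = ∫ U, r 2 U ^ 4 ∂μ := by
    simpa only [pauliExpectation_axisCycle] using
      integral_comp_mulVec_unitary_mulVec μ axisCycle e₀ (fun ψ => pauliExpectation 2 ψ ^ 4)
  have h3112 : ∫ U, r 3 U ^ 2 * r 1 U ^ 2 ∂μ = ∫ U, r 1 U ^ 2 * r 2 U ^ 2 ∂μ := by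
    simpa only [pauliExpectation_axisCycle] using
      integral_comp_mulVec_unitary_mulVec μ axisCycle e₀
        (fun ψ => pauliExpectation 1 ψ ^ 2 * pauliExpectation 2 ψ ^ 2)
  have h1223 : ∫ U, r 1 U ^ 2 * r 2 U ^ 2 ∂μ = ∫ U, r 2 U ^ 2 * r 3 U ^ 2 ∂μ := by
    simpa only [pauliExpectation_axisCycle] using
      integral_comp_mulVec_unitary_mulVec μ axisCycle e₀
        (fun ψ => pauliExpectation 2 ψ ^ 2 * pauliExpectation 3 ψ ^ 2)
  have hrot (c s : ℝ) (h : c ^ 2 + s ^ 2 = 1) :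
      c ^ 4 * ∫ U, r 1 U ^ 4 ∂μ - 4 * c ^ 3 * s * ∫ U, r 1 U ^ 3 * r 2 U ^ 1 ∂μ +
        6 * c ^ 2 * s ^ 2 * ∫ U, r 1 U ^ 2 * r 2 U ^ 2 ∂μ -
        4 * c * s ^ 3 * ∫ U, r 1 U ^ 1 * r 2 U ^ 3 ∂μ + s ^ 4 * ∫ U, r 2 U ^ 4 ∂μ =
      ∫ U, r 1 U ^ 4 ∂μ := by
    have h1 : ∫ U, (c * r 1 U - s * r 2 U) ^ 4 ∂μ = ∫ U, r 1 U ^ 4 ∂μ := by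
      simpa only [pauliExpectation_one_phaseGate] using
        integral_comp_mulVec_unitary_mulVec μ (phaseGate c s h) e₀
          (fun ψ => pauliExpectation 1 ψ ^ 4)
    have hexp (U : unitaryGroup (Fin 2) ℂ) : (c * r 1 U - s * r 2 U) ^ 4 =
        c ^ 4 * r 1 U ^ 4 - 4 * c ^ 3 * s * (r 1 U ^ 3 * r 2 U ^ 1) +
        6 * c ^ 2 * s ^ 2 * (r 1 U ^ 2 * r 2 U ^ 2) -
        4 * c * s ^ 3 * (r 1 U ^ 1 * r 2 U ^ 3) + s ^ 4 * r 2 U ^ 4 := by ring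
    have i4 (a : Fin 4) (C : ℝ) := (hint4 a).const_mul C
    have i (k l : ℕ) (C : ℝ) := (hint 1 2 k l).const_mul C
    have i2 := (i4 1 (c ^ 4)).sub' (i 3 1 (4 * c ^ 3 * s))
    have i3 := i2.fun_add (i 2 2 (6 * c ^ 2 * s ^ 2))
    rw [integral_congr_ae (.of_forall hexp),
      integral_add (i3.sub' (i _ _ _)) (i4 _ _), integral_sub i3 (i _ _ _),
      integral_add i2 (i _ _ _), integral_sub (i4 _ _) (i _ _ _)] at h1
    simpa only [integral_const_mul] using h1
  have hnorm : ∫ U, r 1 U ^ 4 ∂μ + ∫ U, r 2 U ^ 4 ∂μ + ∫ U, r 3 U ^ 4 ∂μ +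
      2 * ∫ U, r 1 U ^ 2 * r 2 U ^ 2 ∂μ + 2 * ∫ U, r 2 U ^ 2 * r 3 U ^ 2 ∂μ +
      2 * ∫ U, r 3 U ^ 2 * r 1 U ^ 2 ∂μ = 1 := by
    have hsq (U : unitaryGroup (Fin 2) ℂ) : r 1 U ^ 4 + r 2 U ^ 4 + r 3 U ^ 4 +
        2 * (r 1 U ^ 2 * r 2 U ^ 2) + 2 * (r 2 U ^ 2 * r 3 U ^ 2) +
        2 * (r 3 U ^ 2 * r 1 U ^ 2) = 1 := by
      have h : r 1 U ^ 2 + r 2 U ^ 2 + r 3 U ^ 2 = 1 := pauliExpectation_sq_add_sq_add_sq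
        ((star_mulVec_dotProduct_mulVec_unitary U e₀).trans he₀)
      linear_combination (r 1 U ^ 2 + r 2 U ^ 2 + r 3 U ^ 2 + 1) * h
    have j (a b : Fin 4) := (hint a b 2 2).const_mul 2
    have i2 := (hint4 1).fun_add (hint4 2)
    have i3 := i2.fun_add (hint4 3)
    have h := integral_congr_ae (μ := μ) (.of_forall hsq)
    rw [integral_add ((i3.fun_add (j _ _)).fun_add (j _ _)) (j _ _),
      integral_add (i3.fun_add (j _ _)) (j _ _), integral_add i3 (j _ _),
      integral_add i2 (hint4 3), integral_add (hint4 1) (hint4 2)] at h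
    simpa only [integral_const_mul, integral_const, probReal_univ, smul_eq_mul, mul_one] using h
  have hplus := hrot (3 / 5) (4 / 5) (by norm_num)
  have hminus := hrot (3 / 5) (-(4 / 5)) (by norm_num)
  change ∫ U, r a U ^ 4 ∂μ = 1 / 5
  fin_cases a <;> dsimp only [Fin.isValue, Fin.zero_eta, Fin.mk_one, Fin.reduceFinMk] at ha ⊢
  · exact absurd rfl ha
  all_goals linarith

/-- the average linear stabilizer entropy of a Haar-random single-qubit
pure state equals 1/5. -/
theorem average_linear_SE_qubit
    (e₀ : Fin 2 → ℂ) (he₀ : star e₀ ⬝ᵥ e₀ = 1)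
    (μ : Measure (Matrix.unitaryGroup (Fin 2) ℂ)) [μ.IsHaarMeasure]
    [IsProbabilityMeasure μ] :
    (∫ U : Matrix.unitaryGroup (Fin 2) ℂ,
        MlinQubit ((U : Matrix (Fin 2) (Fin 2) ℂ).mulVec e₀) ∂μ) = 1 / 5 := by
  have hM (U : Matrix.unitaryGroup (Fin 2) ℂ) :
      MlinQubit ((U : Matrix (Fin 2) (Fin 2) ℂ).mulVec e₀) = 1 / 2 - (2 : ℝ)⁻¹ *
        ∑ a ∈ {1, 2, 3}, pauliExpectation a ((U : Matrix (Fin 2) (Fin 2) ℂ).mulVec e₀) ^ 4 := by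
    have h0 : pauliExpectation 0 ((U : Matrix (Fin 2) (Fin 2) ℂ).mulVec e₀) = 1 := by
      rw [pauliExpectation_zero, star_mulVec_dotProduct_mulVec_unitary, he₀, Complex.one_re]
    change 1 - (2 : ℝ)⁻¹ *
      ∑ a : Fin 4, pauliExpectation a ((U : Matrix (Fin 2) (Fin 2) ℂ).mulVec e₀) ^ 4 = _
    rw [Fin.sum_univ_four, h0]
    simp
    ring
  have hint (a : Fin 4) : Integrable (fun U : Matrix.unitaryGroup (Fin 2) ℂ =>
      pauliExpectation a ((U : Matrix (Fin 2) (Fin 2) ℂ).mulVec e₀) ^ 4) μ := by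
    simpa using integrable_pauliExpectation_pow_mul_pow he₀ μ a a 4 0
  simp_rw [hM]
  rw [integral_sub (integrable_const _) ((integrable_finsetSum _ fun a _ => hint a).const_mul _),
    integral_const_mul, integral_finsetSum _ fun a _ => hint a,
    Finset.sum_congr rfl fun a ha => integral_pauliExpectation_pow_four he₀ μ
      (a := a) (by rintro rfl; simp at ha)]
  simp
  norm_num
end
end

section
/- Let Q⁰ = 16⁻² Σ_{P ∈ 𝒫₄} P^{⊗4} on ((ℂ²)^⊗4)^{⊗4}, and for π ∈ S₄ let T_π^I = Σ_{g : {1,…,4} → {0,1}} ( b_{g(π⁻¹(1))}⊗b_{g(π⁻¹(2))}⊗b_{g(π⁻¹(3))}⊗b_{g(π⁻¹(4))} )( b_{g(1)}⊗b_{g(2)}⊗b_{g(3)}⊗b_{g(4)} )† be the permutation operator restricted to the intertwiner subspace, where b₀ = |0_s⟩ and b₁ = |1_s⟩. Then Σ_{π ∈ S₄} tr( Q⁰ T_π^I ) = 14/3. -/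
open Matrix BigOperators

noncomputable section

/-- The operator `Q⁰ = 16⁻² Σ_{P ∈ 𝒫₄} P^{⊗4}` on `((ℂ²)^⊗4)^{⊗4}`. -/
def Q0 : Matrix (Fin 4 → (Fin 4 → Fin 2)) (Fin 4 → (Fin 4 → Fin 2)) ℂ :=
  ((16 : ℂ) ^ 2)⁻¹ • ∑ f : Fin 4 → Fin 4, kronPow 4 (pauliString f)

/-- The intertwiner logical basis `b₀ = |0_s⟩`, `b₁ = |1_s⟩`. -/
def intBasis : Fin 2 → ((Fin 4 → Fin 2) → ℂ) := ![zeroS, oneS]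

/-- The tensor product `b_{g(1)} ⊗ b_{g(2)} ⊗ b_{g(3)} ⊗ b_{g(4)}` of intertwiner basis
vectors, as a vector of `((ℂ²)^⊗4)^{⊗4}`. -/
def intTensor (g : Fin 4 → Fin 2) : (Fin 4 → (Fin 4 → Fin 2)) → ℂ :=
  fun r => ∏ i, intBasis (g i) (r i)

/-- The permutation operator restricted to the intertwiner subspace,
`T_π^I = Σ_{g : {1,…,4} → {0,1}} |b_{g∘π⁻¹}⟩⟨b_g|`. -/
def permOpI (π : Equiv.Perm (Fin 4)) :
    Matrix (Fin 4 → (Fin 4 → Fin 2)) (Fin 4 → (Fin 4 → Fin 2)) ℂ :=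
  ∑ g : Fin 4 → Fin 2, Matrix.vecMulVec (intTensor (g ∘ ⇑π⁻¹)) (star (intTensor g))

/-- Expectation values of tensor powers factor over the tensor components. -/
theorem trace_kronPow_mul_vecMulVec {ι : Type*} [Fintype ι] (k : ℕ) (A : Matrix ι ι ℂ)
    (v w : Fin k → ι → ℂ) :
    (kronPow k A * vecMulVec (fun r : Fin k → ι => ∏ i, v i (r i))
      (star fun r : Fin k → ι => ∏ i, w i (r i))).trace =
      ∏ i, star (w i) ⬝ᵥ A *ᵥ v i := by
  rw [mul_vecMulVec, trace_vecMulVec]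
  have mulVec_prod : kronPow k A *ᵥ (fun r : Fin k → ι => ∏ i, v i (r i)) =
      fun r => ∏ i, (A *ᵥ v i) (r i) := by
    ext r
    simp only [mulVec, dotProduct, kronPow, of_apply, ← Finset.prod_mul_distrib]
    exact (Fintype.prod_sum fun i c => A (r i) c * v i c).symm
  rw [mulVec_prod, dotProduct_comm]
  simp only [dotProduct, Pi.star_apply, star_prod, ← Finset.prod_mul_distrib]
  exact (Fintype.prod_sum fun i c => star (w i c) * (A *ᵥ v i) c).symm

theorem sum_fin_four_pi {α M : Type*} [Fintype α] [AddCommMonoid M] (F : (Fin 4 → α) → M) :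
    ∑ f, F f = ∑ a, ∑ b, ∑ c, ∑ d, F ![a, b, c, d] := by
  simp only [← (Fin.consEquiv fun _ => α).sum_comp, Fintype.sum_prod_type, Fintype.sum_unique]
  rfl

theorem sum_perm_fin_four {M : Type*} [AddCommMonoid M] (F : (Fin 4 → Fin 4) → M) :
    ∑ π : Equiv.Perm (Fin 4), F π =
      F ![0, 1, 2, 3] + F ![0, 1, 3, 2] + F ![0, 2, 1, 3] + F ![0, 2, 3, 1] +
      F ![0, 3, 2, 1] + F ![0, 3, 1, 2] + F ![1, 0, 2, 3] + F ![1, 0, 3, 2] +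
      F ![1, 2, 0, 3] + F ![1, 2, 3, 0] + F ![1, 3, 2, 0] + F ![1, 3, 0, 2] +
      F ![2, 1, 0, 3] + F ![2, 1, 3, 0] + F ![2, 0, 1, 3] + F ![2, 0, 3, 1] +
      F ![2, 3, 0, 1] + F ![2, 3, 1, 0] + F ![3, 1, 2, 0] + F ![3, 1, 0, 2] +
      F ![3, 2, 1, 0] + F ![3, 2, 0, 1] + F ![3, 0, 2, 1] + F ![3, 0, 1, 2] := by
  simp only [← Equiv.Perm.decomposeFin.symm.sum_comp, Fintype.sum_prod_type, Fin.sum_univ_four,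
    Fin.sum_univ_three, Fin.sum_univ_two, Fintype.sum_unique, add_assoc]
  repeat' refine congrArg₂ HAdd.hAdd ?_ ?_
  all_goals exact congrArg F (by decide)

/-- `∑_π tr(B^{⊗4} T_π)` is `4!` times the complete homogeneous symmetric polynomial of degree
four in the eigenvalues of the `2 × 2` matrix `B`. -/
theorem sum_perm_sum_prod {R : Type*} [CommRing R] (B : Matrix (Fin 2) (Fin 2) R) :
    ∑ π : Equiv.Perm (Fin 4), ∑ g : Fin 4 → Fin 2, ∏ i, B (g i) (g (π⁻¹ i)) =
      24 * (B.trace ^ 4 - 3 * B.trace ^ 2 * B.det + B.det ^ 2) := by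
  have sum_inv : ∑ π : Equiv.Perm (Fin 4), ∑ g : Fin 4 → Fin 2, ∏ i, B (g i) (g (π⁻¹ i)) =
      ∑ π : Equiv.Perm (Fin 4), ∑ g : Fin 4 → Fin 2, ∏ i, B (g i) (g (π i)) :=
    Equiv.sum_comp (Equiv.inv (Equiv.Perm (Fin 4)))
      fun π => ∑ g : Fin 4 → Fin 2, ∏ i, B (g i) (g (π i))
  rw [sum_inv, sum_perm_fin_four fun p => ∑ g : Fin 4 → Fin 2, ∏ i, B (g i) (g (p i))]
  simp only [sum_fin_four_pi, Fin.prod_univ_four, Fin.sum_univ_two, trace_fin_two, det_fin_two,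
    cons_val]
  ring

/-- The Pauli matrix `σ_a` maps the basis vector `|x⟩` to a multiple of `|pauliShift a x⟩`. -/
def pauliShift : Fin 4 → Fin 2 → Fin 2 :=
  ![![0, 1], ![1, 0], ![1, 0], ![0, 1]]

/-- The sign picked up by `σ_a` on `|x⟩`, once the factor `pauliPhase a` is taken out. -/
def pauliSign : Fin 4 → Fin 2 → ℤ :=
  ![![1, 1], ![1, 1], ![1, -1], ![1, -1]]

def pauliPhase : Fin 4 → ℂ :=
  ![1, 1, Complex.I, 1]

theorem pauliPhase_pow_four (a : Fin 4) : pauliPhase a ^ 4 = 1 := by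
  fin_cases a <;> simp [pauliPhase]

theorem pauli_apply (a : Fin 4) (r c : Fin 2) :
    pauli a r c = pauliPhase a * if r = pauliShift a c then (pauliSign a c : ℂ) else 0 := by
  fin_cases a <;> fin_cases r <;> fin_cases c <;>
    simp [pauli, pauliPhase, pauliShift, pauliSign]

theorem pauliString_apply {n : ℕ} (f : Fin n → Fin 4) (r c : Fin n → Fin 2) :
    pauliString f r c = (∏ k, pauliPhase (f k)) *
      if r = fun k => pauliShift (f k) (c k) then ((∏ k, pauliSign (f k) (c k) : ℤ) : ℂ)
      else 0 := by
  simp [pauliString, pauli_apply, Finset.prod_mul_distrib, Finset.prod_ite_zero, funext_iff]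

/-- The antisymmetric form on bits, i.e. the unnormalised singlet. -/
def antisym : Fin 2 → Fin 2 → ℤ :=
  ![![0, 1], ![-1, 0]]

/-- The logical basis vectors up to normalisation, as combinations of products of singlets. -/
def intVec : Fin 2 → Fin 2 → Fin 2 → Fin 2 → Fin 2 → ℤ
  | 0, w, x, y, z => antisym w x * antisym y z
  | 1, w, x, y, z => antisym w y * antisym x z + antisym w z * antisym x y

/-- The normalisation of the vectors `intVec`. -/
def intNorm : Fin 2 → ℂ :=
  ![2⁻¹, (2 * (Real.sqrt 3 : ℂ))⁻¹]

theorem intBasis_apply (i : Fin 2) (b : Fin 4 → Fin 2) :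
    intBasis i b = intNorm i * intVec i (b 0) (b 1) (b 2) (b 3) := by
  obtain ⟨w, x, y, z, rfl⟩ : ∃ w x y z, b = ![w, x, y, z] :=
    ⟨b 0, b 1, b 2, b 3, by ext k; fin_cases k <;> rfl⟩
  fin_cases i <;> fin_cases w <;> fin_cases x <;> fin_cases y <;> fin_cases z <;>
    simp [intBasis, zeroS, oneS, ket, intNorm, intVec, antisym]

theorem star_intNorm (i : Fin 2) : star (intNorm i) = intNorm i := by
  fin_cases i <;> simp [intNorm]

/-- The contribution of the basis vector `|wxyz⟩` to a matrix element of the Pauli string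
`σ_a ⊗ σ_b ⊗ σ_c ⊗ σ_d`. -/
def intGramTerm (a b c d : Fin 4) (i j w x y z : Fin 2) : ℤ :=
  intVec i (pauliShift a w) (pauliShift b x) (pauliShift c y) (pauliShift d z) *
    (pauliSign a w * pauliSign b x * pauliSign c y * pauliSign d z) * intVec j w x y z

/-- Matrix elements of `σ_a ⊗ σ_b ⊗ σ_c ⊗ σ_d` between the logical vectors, without norms and
phases. The sum runs over the balanced bit strings, which support the logical vectors. -/
def intGram (a b c d : Fin 4) (i j : Fin 2) : ℤ :=
  intGramTerm a b c d i j 0 0 1 1 + intGramTerm a b c d i j 1 1 0 0 +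
  intGramTerm a b c d i j 0 1 0 1 + intGramTerm a b c d i j 1 0 1 0 +
  intGramTerm a b c d i j 0 1 1 0 + intGramTerm a b c d i j 1 0 0 1

theorem intGram_eq_sum (a b c d : Fin 4) (i j : Fin 2) :
    intGram a b c d i j = ∑ w, ∑ x, ∑ y, ∑ z, intGramTerm a b c d i j w x y z := by
  fin_cases j <;> simp [intGram, intGramTerm, intVec, antisym] <;> ring

theorem intBasis_pauliString_intBasis (f : Fin 4 → Fin 4) (i j : Fin 2) :
    star (intBasis i) ⬝ᵥ pauliString f *ᵥ intBasis j =
      (∏ k, pauliPhase (f k)) * (intNorm i * intNorm j * intGram (f 0) (f 1) (f 2) (f 3) i j) := by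
  have column (b : Fin 4 → Fin 2) : (∑ r, star (intBasis i r) * pauliString f r b) * intBasis j b =
      (∏ k, pauliPhase (f k)) * (intNorm i * intNorm j *
        (intGramTerm (f 0) (f 1) (f 2) (f 3) i j (b 0) (b 1) (b 2) (b 3) : ℤ)) := by
    simp only [pauliString_apply, mul_ite, mul_zero, Finset.sum_ite_eq',
      Finset.mem_univ, if_true, intBasis_apply, star_mul', star_intNorm, intGramTerm,
      Fin.prod_univ_four, star_intCast]
    push_cast
    ring
  rw [dotProduct_mulVec, intGram_eq_sum]
  simp only [dotProduct, vecMul, Pi.star_apply, column]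
  rw [← Finset.mul_sum, ← Finset.mul_sum, sum_fin_four_pi]
  push_cast
  rfl

/-- `12⁴` times the degree four complete homogeneous symmetric polynomial in the eigenvalues of a
`2 × 2` matrix with diagonal entries `a / 4`, `b / 12` and off-diagonal product `e / 48`. -/
def scaledSymTrace (a b e : ℤ) : ℤ :=
  (3 * a + b) ^ 4 - 9 * (3 * a + b) ^ 2 * (a * b - e) + 9 * (a * b - e) ^ 2

theorem sum_scaledSymTrace_intGram :
    ∑ f : Fin 4 → Fin 4, (let m := intGram (f 0) (f 1) (f 2) (f 3)
      scaledSymTrace (m 0 0) (m 1 1) (m 0 1 * m 1 0)) = 1032192 := by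
  rw [sum_fin_four_pi]
  simp only [cons_val, Fin.sum_univ_four]
  decide +kernel

theorem sum_perm_trace_kronPow_pauliString (f : Fin 4 → Fin 4) :
    ∑ π : Equiv.Perm (Fin 4), (kronPow 4 (pauliString f) * permOpI π).trace =
      24 * (let m := intGram (f 0) (f 1) (f 2) (f 3)
        scaledSymTrace (m 0 0) (m 1 1) (m 0 1 * m 1 0) : ℤ) / 12 ^ 4 := by
  set m := intGram (f 0) (f 1) (f 2) (f 3) with hm
  let B : Matrix (Fin 2) (Fin 2) ℂ :=
    of fun i j => star (intBasis i) ⬝ᵥ pauliString f *ᵥ intBasis j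
  have trace_eq (π : Equiv.Perm (Fin 4)) : (kronPow 4 (pauliString f) * permOpI π).trace =
      ∑ g : Fin 4 → Fin 2, ∏ i, B (g i) (g (π⁻¹ i)) := by
    rw [permOpI, Finset.mul_sum, trace_sum]
    exact Finset.sum_congr rfl fun g _ => trace_kronPow_mul_vecMulVec 4 (pauliString f)
      (fun i => intBasis (g (π⁻¹ i))) fun i => intBasis (g i)
  have phase : (∏ k, pauliPhase (f k)) ^ 4 = 1 := by
    simp [← Finset.prod_pow, pauliPhase_pow_four]
  have norm_zero : intNorm 0 = 1 / 2 := by simp [intNorm]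
  have norm_one : intNorm 1 ^ 2 = 1 / 12 := by
    have sqrt_sq : (Real.sqrt 3 : ℂ) ^ 2 = 3 := by norm_cast; simp
    simp only [intNorm, cons_val_one, cons_val_fin_one, inv_pow, mul_pow, sqrt_sq]
    norm_num
  have trace_B : B.trace = (∏ k, pauliPhase (f k)) *
      ((3 * m 0 0 + m 1 1) / 12) := by
    simp only [B, trace_fin_two, of_apply, intBasis_pauliString_intBasis, ← hm, norm_zero]
    linear_combination (∏ k, pauliPhase (f k)) * m 1 1 * norm_one
  have det_B : B.det = (∏ k, pauliPhase (f k)) ^ 2 *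
      ((m 0 0 * m 1 1 - m 0 1 * m 1 0) / 48) := by
    simp only [B, det_fin_two, of_apply, intBasis_pauliString_intBasis, ← hm, norm_zero]
    linear_combination (∏ k, pauliPhase (f k)) ^ 2 / 4 *
      (m 0 0 * m 1 1 - m 0 1 * m 1 0) * norm_one
  simp only [trace_eq, sum_perm_sum_prod, trace_B, det_B]
  trans (∏ k, pauliPhase (f k)) ^ 4 *
    (24 * (scaledSymTrace (m 0 0) (m 1 1) (m 0 1 * m 1 0) : ℤ) / 12 ^ 4)
  · simp only [scaledSymTrace]
    push_cast
    ring
  · rw [phase, one_mul]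

/-- `Σ_{π ∈ S₄} tr( Q⁰ T_π^I ) = 14/3`. -/
theorem trace_Q0_intertwiner_perm_sum :
    ∑ π : Equiv.Perm (Fin 4), (Q0 * permOpI π).trace = 14 / 3 := by
  simp only [Q0, Matrix.smul_mul, Matrix.sum_mul, trace_smul, trace_sum, ← Finset.smul_sum]
  rw [Finset.sum_comm]
  simp only [sum_perm_trace_kronPow_pauliString, ← Finset.sum_div, ← Finset.mul_sum,
    ← Int.cast_sum, sum_scaledSymTrace_intGram]
  norm_num
end
end
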